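/- arXiv:math/0403079 — 4 statements merged into one kernel-verified Lean document; each statement's English description precedes it below -/
import Mathlib

section
/- Let k ≥ 1 be an integer and f a function holomorphic near 0 ∈ ℂ² with f(0,0) ≠ 0. Consider the vector fields X = f(x,y)∂x + y^k∂y and X₀ = ∂x + y^k∂y. Then there exists a unique holomorphic function φ defined near 0 ∈ ℂ² with φ(0,y) = 0 for all y near 0 such that Φ(x,y) := (φ(x,y), y) is a local biholomorphism at 0 satisfying DΦ(p)·X(p) = X₀(Φ(p)) for all p near 0. Moreover φ(x,0) = ∫₀ˣ dζ / f(ζ,0) for x near 0, and the restriction of Φ to the horizontal axis is the identity (i.e. φ(x,0) = x for all x near 0) if and only if f(x,0) = 1 for all x near 0. -/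
open Filter

open scoped BoundedContinuousFunction

/-- A weighted composition operator on bounded double sequences. -/
noncomputable def weightedComp (a : ℕ × ℕ → ℂ) (σ : ℕ × ℕ → ℕ × ℕ) (C : ℝ)
    (h : ∀ i, ‖a i‖ ≤ C) : ((ℕ × ℕ) →ᵇ ℂ) →L[ℂ] ((ℕ × ℕ) →ᵇ ℂ) :=
  LinearMap.mkContinuous
    { toFun := fun u => BoundedContinuousFunction.ofNormedAddCommGroupDiscrete
        (fun i => a i * u (σ i)) (C * ‖u‖) (fun i => by
          rw [norm_mul]
          exact mul_le_mul (h i) (u.norm_coe_le_norm _) (norm_nonneg _)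
            ((norm_nonneg _).trans (h i)))
      map_add' := fun u v => by ext i; simp [mul_add]
      map_smul' := fun c u => by ext i; simp; ring }
    C (fun u => by
      refine (BoundedContinuousFunction.norm_le
        (mul_nonneg ((norm_nonneg _).trans (h 0)) (norm_nonneg _))).2 fun i => ?_
      change ‖a i * u (σ i)‖ ≤ _
      rw [norm_mul]
      exact mul_le_mul (h i) (u.norm_coe_le_norm _) (norm_nonneg _)
        ((norm_nonneg _).trans (h i)))

@[simp] lemma weightedComp_apply (a σ C h) (u : (ℕ × ℕ) →ᵇ ℂ) (i : ℕ × ℕ) :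
    weightedComp a σ C h u i = a i * u (σ i) := rfl

lemma norm_weightedComp_le (a σ C h) : ‖weightedComp a σ C h‖ ≤ C :=
  LinearMap.mkContinuous_norm_le _ ((norm_nonneg _).trans (h 0)) _

/-- The right shift in the first index. -/
noncomputable def shiftFst : ((ℕ × ℕ) →ᵇ ℂ) →L[ℂ] ((ℕ × ℕ) →ᵇ ℂ) :=
  weightedComp (fun i => if i.1 = 0 then 0 else 1) (fun i => (i.1 - 1, i.2)) 1
    (fun i => by split_ifs <;> simp)

/-- The right shift in the second index. -/
noncomputable def shiftSnd : ((ℕ × ℕ) →ᵇ ℂ) →L[ℂ] ((ℕ × ℕ) →ᵇ ℂ) :=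
  weightedComp (fun i => if i.2 = 0 then 0 else 1) (fun i => (i.1, i.2 - 1)) 1
    (fun i => by split_ifs <;> simp)

/-- The sequence supported at the origin with value `1`. -/
noncomputable def deltaZero : (ℕ × ℕ) →ᵇ ℂ :=
  BoundedContinuousFunction.ofNormedAddCommGroupDiscrete
    (fun i => if i = 0 then 1 else 0) 1 (fun i => by split_ifs <;> simp)

lemma deltaZero_apply (i : ℕ × ℕ) : deltaZero i = if i = 0 then 1 else 0 := rfl

/-- The double sequence `(i + j).choose i * (x / r) ^ i * (y / s) ^ j`, as a resolvent. -/
noncomputable def monomials (r s : ℝ) (p : ℂ × ℂ) : (ℕ × ℕ) →ᵇ ℂ :=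
  Ring.inverse (1 - ((p.1 / r) • shiftFst + (p.2 / s) • shiftSnd)) deltaZero

lemma norm_shift_lt {r s : ℝ} {p : ℂ × ℂ} (h : ‖p.1 / r‖ + ‖p.2 / s‖ < 1) :
    ‖(p.1 / r) • shiftFst + (p.2 / s) • shiftSnd‖ < 1 := by
  refine lt_of_le_of_lt (norm_add_le _ _) (lt_of_le_of_lt ?_ h)
  rw [norm_smul, norm_smul]
  exact add_le_add
    (mul_le_of_le_one_right (norm_nonneg _) (norm_weightedComp_le _ _ _ _))
    (mul_le_of_le_one_right (norm_nonneg _) (norm_weightedComp_le _ _ _ _))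

lemma isUnit_one_sub_shift {r s : ℝ} {p : ℂ × ℂ} (h : ‖p.1 / r‖ + ‖p.2 / s‖ < 1) :
    IsUnit (1 - ((p.1 / r) • shiftFst + (p.2 / s) • shiftSnd)) :=
  isUnit_one_sub_of_norm_lt_one (R := ((ℕ × ℕ) →ᵇ ℂ) →L[ℂ] ((ℕ × ℕ) →ᵇ ℂ)) (norm_shift_lt h)

lemma monomials_apply {r s : ℝ} {p : ℂ × ℂ} (h : ‖p.1 / r‖ + ‖p.2 / s‖ < 1) (i j : ℕ) :
    monomials r s p (i, j) = ((i + j).choose i : ℂ) * (p.1 / r) ^ i * (p.2 / s) ^ j := by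
  have hu := isUnit_one_sub_shift h
  have key : (1 - ((p.1 / r) • shiftFst + (p.2 / s) • shiftSnd)) (monomials r s p) =
      deltaZero := by
    rw [monomials, ← mul_apply_eq_comp, Ring.mul_inverse_cancel _ hu]
    rfl
  have hrec : ∀ i : ℕ × ℕ, monomials r s p i = (if i = 0 then 1 else 0) +
      (p.1 / r) * ((if i.1 = 0 then 0 else 1) * monomials r s p (i.1 - 1, i.2)) +
      (p.2 / s) * ((if i.2 = 0 then 0 else 1) * monomials r s p (i.1, i.2 - 1)) := by
    intro i
    have := DFunLike.congr_fun key i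
    simp [shiftFst, shiftSnd, deltaZero_apply] at this
    simp
    linear_combination this
  generalize hn : i + j = n
  induction n generalizing i j with
  | zero =>
    obtain ⟨rfl, rfl⟩ : i = 0 ∧ j = 0 := by omega
    rw [hrec]; simp
  | succ n ih =>
    rw [hrec]
    rcases i with _ | i
    · rcases j with _ | j
      · omega
      · have := ih 0 j (by omega)
        simp [this]; ring
    · rcases j with _ | j
      · have := ih i 0 (by omega)
        obtain rfl : i = n := by omega
        simp [this]; ring
      · have h1 := ih i (j + 1) (by omega)
        have h2 := ih (i + 1) j (by omega)
        simp [h1, h2, Nat.choose_succ_succ]; ring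

lemma analyticAt_monomials {r s : ℝ} {p : ℂ × ℂ} (h : ‖p.1 / r‖ + ‖p.2 / s‖ < 1) :
    AnalyticAt ℂ (monomials r s) p := by
  obtain ⟨u, hu⟩ := isUnit_one_sub_shift h
  have h1 : AnalyticAt ℂ (fun p : ℂ × ℂ =>
      (1 : ((ℕ × ℕ) →ᵇ ℂ) →L[ℂ] ((ℕ × ℕ) →ᵇ ℂ)) -
        ((p.1 / r) • shiftFst + (p.2 / s) • shiftSnd)) p :=
    analyticAt_const.sub (((analyticAt_fst.div_const).smul analyticAt_const).add
      ((analyticAt_snd.div_const).smul analyticAt_const))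
  have h3 := analyticAt_inverse (𝕜 := ℂ) (A := ((ℕ × ℕ) →ᵇ ℂ) →L[ℂ] ((ℕ × ℕ) →ᵇ ℂ)) u
  rw [hu] at h3
  have h2 := AnalyticAt.fun_comp (x := p) h3 h1
  exact ((ContinuousLinearMap.apply ℂ ((ℕ × ℕ) →ᵇ ℂ) deltaZero).analyticAt _).comp h2

/-- The operator acting on `monomials r s (x, y)` as multiplication by `x`. -/
noncomputable def mulFst (r : ℝ) : ((ℕ × ℕ) →ᵇ ℂ) →L[ℂ] ((ℕ × ℕ) →ᵇ ℂ) :=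
  weightedComp (fun i => r * ((i.1 + 1) / (i.1 + i.2 + 1) : ℝ)) (fun i => (i.1 + 1, i.2)) |r|
    (fun i => by
      rw [norm_mul, Complex.norm_real, Complex.norm_real, Real.norm_eq_abs, Real.norm_eq_abs]
      refine mul_le_of_le_one_right (abs_nonneg _) ?_
      rw [abs_of_nonneg (by positivity)]
      exact div_le_one_of_le₀ (by linarith [(Nat.cast_nonneg i.2 : (0:ℝ) ≤ _)]) (by positivity))

/-- The operator acting on `monomials r s (x, y)` as multiplication by `y`. -/
noncomputable def mulSnd (s : ℝ) : ((ℕ × ℕ) →ᵇ ℂ) →L[ℂ] ((ℕ × ℕ) →ᵇ ℂ) :=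
  weightedComp (fun i => s * ((i.2 + 1) / (i.1 + i.2 + 1) : ℝ)) (fun i => (i.1, i.2 + 1)) |s|
    (fun i => by
      rw [norm_mul, Complex.norm_real, Complex.norm_real, Real.norm_eq_abs, Real.norm_eq_abs]
      refine mul_le_of_le_one_right (abs_nonneg _) ?_
      rw [abs_of_nonneg (by positivity)]
      exact div_le_one_of_le₀ (by linarith [(Nat.cast_nonneg i.1 : (0:ℝ) ≤ _)]) (by positivity))

/-- The operator acting on `monomials r s (x, y)` as the primitive in `x` vanishing at `x = 0`. -/
noncomputable def primFst (r : ℝ) : ((ℕ × ℕ) →ᵇ ℂ) →L[ℂ] ((ℕ × ℕ) →ᵇ ℂ) :=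
  weightedComp (fun i => r * (1 / (i.1 + i.2 + 1) : ℝ)) (fun i => (i.1 + 1, i.2)) |r|
    (fun i => by
      rw [norm_mul, Complex.norm_real, Complex.norm_real, Real.norm_eq_abs, Real.norm_eq_abs]
      refine mul_le_of_le_one_right (abs_nonneg _) ?_
      rw [abs_of_nonneg (by positivity)]
      exact div_le_one_of_le₀ (by
        linarith [(Nat.cast_nonneg i.1 : (0:ℝ) ≤ _), (Nat.cast_nonneg i.2 : (0:ℝ) ≤ _)])
        (by positivity))

/-- The operator acting on `monomials r s (x, y)` as the `y`-derivative of the primitive in `x`. -/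
noncomputable def derivPrim (r s : ℝ) : ((ℕ × ℕ) →ᵇ ℂ) →L[ℂ] ((ℕ × ℕ) →ᵇ ℂ) :=
  weightedComp (fun i => if i.2 = 0 then 0 else (r / s : ℝ)) (fun i => (i.1 + 1, i.2 - 1)) |r / s|
    (fun i => by
      split_ifs
      · simp
      · rw [Complex.norm_real, Real.norm_eq_abs])

lemma choose_succ_fst (i j : ℕ) :
    (((i + 1 + j).choose (i + 1) : ℕ) : ℂ) * (i + 1) = (i + j + 1) * ((i + j).choose i : ℕ) := by
  have := Nat.add_one_mul_choose_eq (i + j) i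
  rw [show i + 1 + j = i + j + 1 by ring]
  exact_mod_cast this.symm

lemma choose_succ_snd (i j : ℕ) :
    (((i + (j + 1)).choose i : ℕ) : ℂ) * (j + 1) = (i + j + 1) * ((i + j).choose i : ℕ) := by
  have := Nat.add_one_mul_choose_eq (i + j) j
  rw [show (i + (j + 1)).choose i = (i + j + 1).choose (j + 1) from
      Nat.choose_symm_of_eq_add (by ring),
    show (i + j).choose i = (i + j).choose j from Nat.choose_symm_of_eq_add (by ring)]
  exact_mod_cast this.symm

lemma mulFst_monomials {r s : ℝ} (hr : r ≠ 0) {p : ℂ × ℂ} (h : ‖p.1 / r‖ + ‖p.2 / s‖ < 1) :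
    mulFst r (monomials r s p) = p.1 • monomials r s p := by
  ext ⟨i, j⟩
  have hij : (i + j + 1 : ℂ) ≠ 0 := by exact_mod_cast (i + j).succ_ne_zero
  have hr' : (r : ℂ) ≠ 0 := by exact_mod_cast hr
  have hp : p.1 = r * (p.1 / r) := by field_simp
  simp only [mulFst, weightedComp_apply, monomials_apply h, BoundedContinuousFunction.coe_smul,
    smul_eq_mul]
  generalize p.1 / r = ξ at *
  rw [hp]
  push_cast
  field_simp
  linear_combination (ξ ^ (i + 1)) * (p.2 / s) ^ j * choose_succ_fst i j

lemma mulSnd_monomials {r s : ℝ} (hs : s ≠ 0) {p : ℂ × ℂ} (h : ‖p.1 / r‖ + ‖p.2 / s‖ < 1) :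
    mulSnd s (monomials r s p) = p.2 • monomials r s p := by
  ext ⟨i, j⟩
  have hij : (i + j + 1 : ℂ) ≠ 0 := by exact_mod_cast (i + j).succ_ne_zero
  have hs' : (s : ℂ) ≠ 0 := by exact_mod_cast hs
  have hp : p.2 = s * (p.2 / s) := by field_simp
  simp only [mulSnd, weightedComp_apply, monomials_apply h, BoundedContinuousFunction.coe_smul,
    smul_eq_mul]
  generalize p.2 / s = η at *
  rw [hp]
  push_cast
  field_simp
  linear_combination ((p.1 / r) ^ i) * η ^ (j + 1) * choose_succ_snd i j

lemma primFst_monomials_of_fst_eq_zero {r s : ℝ} {p : ℂ × ℂ} (h : ‖p.1 / r‖ + ‖p.2 / s‖ < 1)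
    (hp : p.1 = 0) : primFst r (monomials r s p) = 0 := by
  ext ⟨i, j⟩
  simp [primFst, monomials_apply h, hp]

lemma isOpen_monomials_domain (r s : ℝ) : IsOpen {p : ℂ × ℂ | ‖p.1 / r‖ + ‖p.2 / s‖ < 1} :=
  isOpen_lt (by fun_prop) continuous_const

lemma hasFDerivAt_primFst_monomials {r s : ℝ} (hr : r ≠ 0) (hs : s ≠ 0) {p : ℂ × ℂ}
    (h : ‖p.1 / r‖ + ‖p.2 / s‖ < 1) :
    HasFDerivAt (fun q => primFst r (monomials r s q))
      ((ContinuousLinearMap.fst ℂ ℂ ℂ).smulRight (monomials r s p) +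
        (ContinuousLinearMap.snd ℂ ℂ ℂ).smulRight (derivPrim r s (monomials r s p))) p := by
  have hr' : (r : ℂ) ≠ 0 := by exact_mod_cast hr
  have hs' : (s : ℂ) ≠ 0 := by exact_mod_cast hs
  obtain ⟨x, y⟩ := p
  have hD := ((primFst r).hasFDerivAt.comp _
    (analyticAt_monomials h).differentiableAt.hasFDerivAt)
  set D := (primFst r).comp (fderiv ℂ (monomials r s) (x, y))
  have hcoord : ∀ i j : ℕ, ∀ᶠ q : ℂ × ℂ in nhds (x, y), (primFst r (monomials r s q)) (i, j) =
      r * (1 / (i + j + 1)) * (((i + 1 + j).choose (i + 1) : ℂ) * (q.1 / r) ^ (i + 1) *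
        (q.2 / s) ^ j) := by
    intro i j
    filter_upwards [(isOpen_monomials_domain r s).mem_nhds h] with q hq
    simp only [primFst, weightedComp_apply, monomials_apply hq]
    push_cast
    rfl
  have hev : ∀ i : ℕ × ℕ, HasFDerivAt (fun q => (primFst r (monomials r s q)) i)
      ((BoundedContinuousFunction.evalCLM ℂ i).comp D) (x, y) := fun i =>
    (BoundedContinuousFunction.evalCLM ℂ i : ((ℕ × ℕ) →ᵇ ℂ) →L[ℂ] ℂ).hasFDerivAt.comp _ hD
  have e1 : D (1, 0) = monomials r s (x, y) := by
    ext ⟨i, j⟩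
    have hij : (i + j + 1 : ℂ) ≠ 0 := by exact_mod_cast (i + j).succ_ne_zero
    have h1 : HasDerivAt (fun t : ℂ => (t, y)) (1, 0) x :=
      (hasDerivAt_id x).prodMk (hasDerivAt_const x y)
    have h2 := HasFDerivAt.comp_hasDerivAt x (hev (i, j)) h1
    have h3 : HasDerivAt (fun t : ℂ => r * (1 / (i + j + 1)) *
        (((i + 1 + j).choose (i + 1) : ℂ) * (t / r) ^ (i + 1) * (y / s) ^ j))
        (r * (1 / (i + j + 1)) * (((i + 1 + j).choose (i + 1) : ℂ) *
          ((i + 1 : ℕ) * (x / r) ^ i * (1 / r)) * (y / s) ^ j)) x :=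
      (((((hasDerivAt_id x).div_const (r : ℂ)).pow (i + 1)).const_mul _).mul_const _).const_mul _
    have h4 := h2.unique (h3.congr_of_eventuallyEq (h1.continuousAt.eventually (hcoord i j)))
    refine h4.trans ?_
    rw [monomials_apply h]
    push_cast
    field_simp
    linear_combination (x / r) ^ i * (y / s) ^ j * choose_succ_fst i j
  have e2 : D (0, 1) = derivPrim r s (monomials r s (x, y)) := by
    ext ⟨i, j⟩
    have hij : (i + j + 1 : ℂ) ≠ 0 := by exact_mod_cast (i + j).succ_ne_zero
    have h1 : HasDerivAt (fun t : ℂ => (x, t)) (0, 1) y :=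
      (hasDerivAt_const y x).prodMk (hasDerivAt_id y)
    have h2 := HasFDerivAt.comp_hasDerivAt y (hev (i, j)) h1
    have h3 : HasDerivAt (fun t : ℂ => r * (1 / (i + j + 1)) *
        (((i + 1 + j).choose (i + 1) : ℂ) * (x / r) ^ (i + 1) * (t / s) ^ j))
        (r * (1 / (i + j + 1)) * (((i + 1 + j).choose (i + 1) : ℂ) * (x / r) ^ (i + 1) *
          (j * (y / s) ^ (j - 1) * (1 / s)))) y :=
      ((((hasDerivAt_id y).div_const (s : ℂ)).pow j).const_mul _).const_mul _
    have h4 := h2.unique (h3.congr_of_eventuallyEq (h1.continuousAt.eventually (hcoord i j)))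
    refine h4.trans ?_
    simp only [derivPrim, weightedComp_apply, monomials_apply h]
    rcases j with _ | j
    · simp
    · have := choose_succ_snd (i + 1) j
      push_cast at this hij ⊢
      field_simp
      linear_combination (x / r) ^ (i + 1) * (y / s) ^ j * this
  refine hD.congr_fderiv ?_
  ext v
  · simp [e1]
  · simp [e2]

lemma ContinuousMultilinearMap.apply_pair_eq_sum {n : ℕ}
    (q : ContinuousMultilinearMap ℂ (fun _ : Fin n => ℂ × ℂ) ℂ) (p : ℂ × ℂ) :
    q (fun _ => p) = ∑ s : Finset (Fin n),
      q (s.piecewise (fun _ => ((1, 0) : ℂ × ℂ)) (fun _ => (0, 1))) *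
        p.1 ^ s.card * p.2 ^ (n - s.card) := by
  have h1 : (fun _ : Fin n => p) = (fun _ => p.1 • ((1, 0) : ℂ × ℂ)) +
      (fun _ => p.2 • ((0, 1) : ℂ × ℂ)) := by
    ext <;> simp
  rw [h1, q.map_add_univ]
  refine Finset.sum_congr rfl fun s _ => ?_
  have h2 : s.piecewise (fun _ : Fin n => p.1 • ((1, 0) : ℂ × ℂ))
      (fun _ => p.2 • ((0, 1) : ℂ × ℂ)) = fun i => s.piecewise (fun _ => p.1) (fun _ => p.2) i •
        s.piecewise (fun _ => ((1, 0) : ℂ × ℂ)) (fun _ => (0, 1)) i := by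
    funext i
    by_cases hi : i ∈ s <;> simp [hi]
  rw [h2, q.map_smul_univ, Finset.prod_piecewise]
  have h3 : (Finset.univ \ s).card = n - s.card := by
    rw [Finset.card_univ_sdiff, Fintype.card_fin]
  simp [h3]
  ring

/-- Double power series expansion of a function analytic at the origin of `ℂ × ℂ`. -/
lemma AnalyticAt.exists_hasSum_monomials {g : ℂ × ℂ → ℂ} (hg : AnalyticAt ℂ g 0) :
    ∃ (ι : Type) (c : ι → ℂ) (a b : ι → ℕ) (ρ : ℝ), 0 < ρ ∧
      Summable (fun i => ‖c i‖ * ρ ^ (a i + b i)) ∧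
      ∀ p : ℂ × ℂ, ‖p.1‖ < ρ → ‖p.2‖ < ρ →
        HasSum (fun i => c i * p.1 ^ a i * p.2 ^ b i) (g p) := by
  obtain ⟨q, R, hq⟩ := hg
  obtain ⟨t, ht0, htR⟩ := ENNReal.lt_iff_exists_nnreal_btwn.1 hq.r_pos
  have ht : 0 < (t : ℝ) := by exact_mod_cast ht0
  let c : (Σ n : ℕ, Finset (Fin n)) → ℂ := fun i =>
    q i.1 (i.2.piecewise (fun _ => ((1, 0) : ℂ × ℂ)) (fun _ => (0, 1)))
  have hc : ∀ i, ‖c i‖ ≤ ‖q i.1‖ := fun i => by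
    refine ((q i.1).le_opNorm _).trans (mul_le_of_le_one_right (norm_nonneg _) ?_)
    refine Finset.prod_le_one (fun _ _ => norm_nonneg _) fun j _ => ?_
    by_cases hj : j ∈ i.2 <;> simp [hj, Prod.norm_def]
  have hab : ∀ i : (Σ n : ℕ, Finset (Fin n)), i.2.card + (i.1 - i.2.card) = i.1 := fun i => by
    have := i.2.card_le_univ
    simp at this
    omega
  have hsum : Summable (fun i : (Σ n : ℕ, Finset (Fin n)) =>
      ‖c i‖ * (t / 2 : ℝ) ^ (i.2.card + (i.1 - i.2.card))) := by
    simp only [hab]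
    rw [summable_sigma_of_nonneg (fun i => by positivity)]
    refine ⟨fun n => Summable.of_finite, ?_⟩
    have h1 : Summable fun n => ‖q n‖ * (t : ℝ) ^ n :=
      q.summable_norm_mul_pow (htR.trans_le hq.r_le)
    refine h1.of_nonneg_of_le (fun n => tsum_nonneg fun s => by positivity) fun n => ?_
    rw [tsum_fintype]
    refine (Finset.sum_le_sum (g := fun _ => ‖q n‖ * (t / 2 : ℝ) ^ n) fun s _ =>
      mul_le_mul_of_nonneg_right (hc ⟨n, s⟩) (by positivity)).trans ?_
    rw [Finset.sum_const, Finset.card_univ, Fintype.card_finset, Fintype.card_fin, nsmul_eq_mul,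
      div_pow]
    push_cast
    field_simp
    exact le_rfl
  refine ⟨_, c, fun i => i.2.card, fun i => i.1 - i.2.card, t / 2, by positivity, hsum,
    fun p h1 h2 => ?_⟩
  have hs : Summable fun i : (Σ n : ℕ, Finset (Fin n)) =>
      c i * p.1 ^ i.2.card * p.2 ^ (i.1 - i.2.card) := by
    refine Summable.of_norm_bounded hsum fun i => ?_
    rw [norm_mul, norm_mul, norm_pow, norm_pow, pow_add, mul_assoc]
    gcongr
  have hp : p ∈ Metric.eball (0 : ℂ × ℂ) R := by
    rw [Metric.mem_eball, edist_zero_right]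
    refine lt_trans ?_ htR
    rw [enorm_eq_nnnorm]
    have : ‖p‖ < t := by
      rw [Prod.norm_def]
      exact max_lt (by linarith) (by linarith)
    exact_mod_cast this
  have h3 := hq.hasSum hp
  rw [zero_add] at h3
  have h4 := hs.hasSum.sigma (fun n => hasSum_fintype _)
  have h5 : (fun n => ∑ s : Finset (Fin n), c ⟨n, s⟩ * p.1 ^ s.card * p.2 ^ (n - s.card)) =
      fun n => q n fun _ => p := by
    funext n
    exact ((q n).apply_pair_eq_sum p).symm
  rw [h5] at h4
  rw [h3.unique h4]
  exact hs.hasSum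

lemma norm_fst_lt_and_norm_snd_lt {r s : ℝ} (hr : 0 < r) (hs : 0 < s) {p : ℂ × ℂ}
    (h : ‖p.1 / r‖ + ‖p.2 / s‖ < 1) : ‖p.1‖ < r ∧ ‖p.2‖ < s := by
  rw [norm_div, norm_div, Complex.norm_real, Complex.norm_real, Real.norm_of_nonneg hr.le,
    Real.norm_of_nonneg hs.le] at h
  have h1 : 0 ≤ ‖p.1‖ / r := by positivity
  have h2 : 0 ≤ ‖p.2‖ / s := by positivity
  exact ⟨(div_lt_one hr).1 (by linarith), (div_lt_one hs).1 (by linarith)⟩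

/-- Multiplication by an analytic function is a bounded operator on double sequences. -/
lemma AnalyticAt.exists_mul_operator {g : ℂ × ℂ → ℂ} (hg : AnalyticAt ℂ g 0) :
    ∃ ρ₀ > (0 : ℝ), ∀ s, 0 < s → s ≤ ρ₀ → ∃ G : ℝ, ∀ r, 0 < r → r ≤ s →
      ∃ M : ((ℕ × ℕ) →ᵇ ℂ) →L[ℂ] ((ℕ × ℕ) →ᵇ ℂ), ‖M‖ ≤ G ∧
        ∀ p : ℂ × ℂ, ‖p.1 / r‖ + ‖p.2 / s‖ < 1 →
          M (monomials r s p) = g p • monomials r s p := by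
  obtain ⟨ι, c, a, b, ρ, hρ, hsum, hval⟩ := hg.exists_hasSum_monomials
  refine ⟨ρ, hρ, fun s hs hsρ => ⟨∑' i, ‖c i‖ * ρ ^ (a i + b i), fun r hr hrs => ?_⟩⟩
  have hX : ‖mulFst r‖ ≤ ρ := (norm_weightedComp_le _ _ _ _).trans
    ((abs_of_pos hr).le.trans (hrs.trans hsρ))
  have hY : ‖mulSnd s‖ ≤ ρ := (norm_weightedComp_le _ _ _ _).trans ((abs_of_pos hs).le.trans hsρ)
  have : Nontrivial ((ℕ × ℕ) →ᵇ ℂ) := ⟨deltaZero, 0, fun h => by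
    simpa [deltaZero_apply] using DFunLike.congr_fun h (0, 0)⟩
  have hbound : ∀ i, ‖c i • (mulFst r ^ a i * mulSnd s ^ b i)‖ ≤ ‖c i‖ * ρ ^ (a i + b i) := by
    intro i
    rw [norm_smul, pow_add]
    refine mul_le_mul_of_nonneg_left ((norm_mul_le _ _).trans ?_) (norm_nonneg _)
    have h1 : ‖mulFst r ^ a i‖ ≤ ρ ^ a i := (norm_pow_le _ _).trans (by gcongr)
    have h2 : ‖mulSnd s ^ b i‖ ≤ ρ ^ b i := (norm_pow_le _ _).trans (by gcongr)
    exact mul_le_mul h1 h2 (norm_nonneg _) (by positivity)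
  refine ⟨∑' i, c i • (mulFst r ^ a i * mulSnd s ^ b i),
    tsum_of_norm_bounded hsum.hasSum hbound, fun p hp => ?_⟩
  obtain ⟨h1, h2⟩ := norm_fst_lt_and_norm_snd_lt hr hs hp
  have hXp : ∀ n : ℕ, (mulFst r ^ n) (monomials r s p) = p.1 ^ n • monomials r s p := by
    intro n
    induction n with
    | zero => simp
    | succ n ih =>
      rw [pow_succ, mul_apply_eq_comp, mulFst_monomials hr.ne' hp, map_smul, ih, smul_smul, pow_succ']
  have hYp : ∀ n : ℕ, (mulSnd s ^ n) (monomials r s p) = p.2 ^ n • monomials r s p := by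
    intro n
    induction n with
    | zero => simp
    | succ n ih =>
      rw [pow_succ, mul_apply_eq_comp, mulSnd_monomials hs.ne' hp, map_smul, ih, smul_smul, pow_succ']
  have h3 := ((Summable.of_norm_bounded hsum hbound).hasSum).mapL
    (ContinuousLinearMap.apply ℂ ((ℕ × ℕ) →ᵇ ℂ) (monomials r s p))
  have h4 := (hval p (by linarith) (by linarith)).smul_const (monomials r s p)
  refine h3.unique (h4.congr_fun fun i => ?_)
  change c i • (mulFst r ^ a i * mulSnd s ^ b i) (monomials r s p) = _
  rw [mul_apply_eq_comp, hYp, map_smul, hXp, smul_smul, smul_smul]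
  congr 1
  ring

lemma eqOn_zero_of_fderiv_fst_eq_zero {u : ℂ × ℂ → ℂ} {δ : ℝ} (hδ : 0 < δ)
    (hd : ∀ p ∈ Metric.ball (0 : ℂ × ℂ) δ, DifferentiableAt ℂ u p)
    (hu : ∀ p ∈ Metric.ball (0 : ℂ × ℂ) δ, fderiv ℂ u p (1, 0) = 0)
    (h0 : ∀ y ∈ Metric.ball (0 : ℂ) δ, u (0, y) = 0) :
    ∀ p ∈ Metric.ball (0 : ℂ × ℂ) δ, u p = 0 := by
  rintro ⟨x, y⟩ hp
  rw [← Prod.mk_zero_zero, ← ball_prod_same] at hp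
  obtain ⟨hx, hy⟩ := hp
  have hmem : ∀ t ∈ Metric.ball (0 : ℂ) δ, (t, y) ∈ Metric.ball (0 : ℂ × ℂ) δ := fun t ht => by
    rw [← Prod.mk_zero_zero, ← ball_prod_same]
    exact ⟨ht, hy⟩
  have hder : ∀ t ∈ Metric.ball (0 : ℂ) δ, HasDerivAt (fun t => u (t, y)) 0 t := fun t ht => by
    have := HasFDerivAt.comp_hasDerivAt t (hd _ (hmem t ht)).hasFDerivAt
      ((hasDerivAt_id t).prodMk (hasDerivAt_const t y))
    rwa [hu _ (hmem t ht)] at this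
  have h1 := Metric.isOpen_ball.is_const_of_deriv_eq_zero (f := fun t => u (t, y))
    (convex_ball (0 : ℂ) δ).isPreconnected
    (fun t ht => (hder t ht).differentiableAt.differentiableWithinAt)
    (fun t ht => (hder t ht).deriv) hx (Metric.mem_ball_self hδ)
  exact h1.trans (h0 y hy)

lemma hasFDerivAt_functional_primFst {r s : ℝ} (hr : 0 < r) (hs : 0 < s)
    (l : ((ℕ × ℕ) →ᵇ ℂ) →L[ℂ] ℂ) {p : ℂ × ℂ} (hp : ‖p.1 / r‖ + ‖p.2 / s‖ < 1) :
    HasFDerivAt (fun q => l (primFst r (monomials r s q)))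
      ((ContinuousLinearMap.fst ℂ ℂ ℂ).smulRight (l (monomials r s p)) +
        (ContinuousLinearMap.snd ℂ ℂ ℂ).smulRight (l (derivPrim r s (monomials r s p)))) p := by
  refine (l.hasFDerivAt.comp p (hasFDerivAt_primFst_monomials hr.ne' hs.ne' hp)).congr_fderiv ?_
  ext <;> simp

lemma fderiv_functional_primFst {r s : ℝ} (hr : 0 < r) (hs : 0 < s)
    (l : ((ℕ × ℕ) →ᵇ ℂ) →L[ℂ] ℂ) {p : ℂ × ℂ} (hp : ‖p.1 / r‖ + ‖p.2 / s‖ < 1) (v : ℂ × ℂ) :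
    fderiv ℂ (fun q => l (primFst r (monomials r s q))) p v =
      v.1 * l (monomials r s p) + v.2 * l (derivPrim r s (monomials r s p)) := by
  rw [(hasFDerivAt_functional_primFst hr hs l hp).fderiv]
  simp

lemma eventually_domain (r s : ℝ) : ∀ᶠ p : ℂ × ℂ in nhds 0, ‖p.1 / r‖ + ‖p.2 / s‖ < 1 :=
  (isOpen_monomials_domain r s).mem_nhds (by simp)

lemma exists_ratio_lt (s G : ℝ) (hs : 0 < s) : ∃ r, 0 < r ∧ r ≤ s ∧ |r / s| * G < 1 := by
  refine ⟨s / (1 + |G|), by positivity,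
    div_le_self hs.le (by linarith [abs_nonneg G]), ?_⟩
  rw [abs_of_pos (by positivity), div_div, div_mul_eq_mul_div, div_lt_one (by positivity)]
  nlinarith [le_abs_self G]

/-- Linear Cauchy–Kovalevskaya theorem, existence. -/
theorem exists_analytic_solution {g h : ℂ × ℂ → ℂ} (hg : AnalyticAt ℂ g 0)
    (hh : AnalyticAt ℂ h 0) :
    ∃ φ : ℂ × ℂ → ℂ, AnalyticAt ℂ φ 0 ∧ (∀ᶠ y in nhds (0 : ℂ), φ (0, y) = 0) ∧
      ∀ᶠ p in nhds (0 : ℂ × ℂ), fderiv ℂ φ p (1, h p) = g p := by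
  obtain ⟨ρg, hρg, Hg⟩ := hg.exists_mul_operator
  obtain ⟨ρh, hρh, Hh⟩ := hh.exists_mul_operator
  have hs : 0 < min ρg ρh := lt_min hρg hρh
  obtain ⟨_, Hg⟩ := Hg _ hs (min_le_left _ _)
  obtain ⟨G, Hh⟩ := Hh _ hs (min_le_right _ _)
  generalize min ρg ρh = s at *
  obtain ⟨r, hr, hrs, hG⟩ := exists_ratio_lt s G hs
  obtain ⟨Mg, -, hMg⟩ := Hg r hr hrs
  obtain ⟨Mh, hMhG, hMh⟩ := Hh r hr hrs
  have hQ : ‖-(derivPrim r s * Mh)‖ < 1 := by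
    rw [norm_neg]
    refine lt_of_le_of_lt ((norm_mul_le _ _).trans ?_) hG
    exact mul_le_mul (norm_weightedComp_le _ _ _ _) hMhG (norm_nonneg _) (abs_nonneg _)
  have hU : IsUnit (1 - -(derivPrim r s * Mh)) :=
    isUnit_one_sub_of_norm_lt_one (R := ((ℕ × ℕ) →ᵇ ℂ) →L[ℂ] ((ℕ × ℕ) →ᵇ ℂ)) hQ
  obtain ⟨T, hT⟩ := hU.exists_left_inv
  let l₁ : ((ℕ × ℕ) →ᵇ ℂ) →L[ℂ] ℂ := BoundedContinuousFunction.evalCLM ℂ (0, 0)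
  let l : ((ℕ × ℕ) →ᵇ ℂ) →L[ℂ] ℂ := l₁.comp (Mg * T)
  refine ⟨fun p => l (primFst r (monomials r s p)), ?_, ?_, ?_⟩
  · exact ((l.comp (primFst r)).analyticAt _).comp (analyticAt_monomials (by simp))
  · have hc : ContinuousAt (fun y : ℂ => ((0, y) : ℂ × ℂ)) 0 := by fun_prop
    filter_upwards [hc.eventually (eventually_domain r s)] with y hy
    rw [primFst_monomials_of_fst_eq_zero hy rfl, map_zero]
  · filter_upwards [eventually_domain r s] with p hp
    rw [fderiv_functional_primFst hr hs l hp]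
    have h1 : h p * l (derivPrim r s (monomials r s p)) =
        l ((derivPrim r s * Mh) (monomials r s p)) := by
      rw [mul_apply_eq_comp, hMh p hp, map_smul, map_smul, smul_eq_mul]
    have h2 : (monomials r s p) = T ((1 - -(derivPrim r s * Mh)) (monomials r s p)) := by
      rw [← mul_apply_eq_comp, hT]
      rfl
    have h3 : l (monomials r s p) + l ((derivPrim r s * Mh) (monomials r s p)) =
        l₁ (Mg (monomials r s p)) := by
      conv_rhs => rw [h2]
      rw [← map_add]
      simp [l]
    rw [h1, one_mul, h3, hMg p hp, map_smul]
    simp [l₁, monomials_apply hp]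

/-- Linear Cauchy–Kovalevskaya theorem, uniqueness. -/
theorem eventually_eq_zero_of_analytic_solution {h ψ : ℂ × ℂ → ℂ} (hh : AnalyticAt ℂ h 0)
    (hψ : AnalyticAt ℂ ψ 0) (hψ0 : ∀ᶠ y in nhds (0 : ℂ), ψ (0, y) = 0)
    (hpde : ∀ᶠ p in nhds (0 : ℂ × ℂ), fderiv ℂ ψ p (1, h p) = 0) :
    ∀ᶠ p in nhds (0 : ℂ × ℂ), ψ p = 0 := by
  have hw : AnalyticAt ℂ (fun p => fderiv ℂ ψ p (1, 0)) 0 :=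
    ((ContinuousLinearMap.apply ℂ ℂ ((1, 0) : ℂ × ℂ)).analyticAt _).comp hψ.fderiv
  obtain ⟨ρg, hρg, Hg⟩ := hw.exists_mul_operator
  obtain ⟨ρh, hρh, Hh⟩ := hh.exists_mul_operator
  have hs : 0 < min ρg ρh := lt_min hρg hρh
  obtain ⟨_, Hg⟩ := Hg _ hs (min_le_left _ _)
  obtain ⟨G, Hh⟩ := Hh _ hs (min_le_right _ _)
  generalize min ρg ρh = s at *
  obtain ⟨r, hr, hrs, hG⟩ := exists_ratio_lt s G hs
  obtain ⟨Mw, -, hMw⟩ := Hg r hr hrs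
  obtain ⟨Mh, hMhG, hMh⟩ := Hh r hr hrs
  have hQ : ‖derivPrim r s * Mh‖ < 1 := by
    refine lt_of_le_of_lt ((norm_mul_le _ _).trans ?_) hG
    exact mul_le_mul (norm_weightedComp_le _ _ _ _) hMhG (norm_nonneg _) (abs_nonneg _)
  set Q := derivPrim r s * Mh with hQdef
  obtain ⟨δ, hδ, hball⟩ := Metric.eventually_nhds_iff_ball.1
    ((eventually_domain r s).and (hpde.and hψ.eventually_analyticAt))
  obtain ⟨δ', hδ', hball'⟩ := Metric.eventually_nhds_iff_ball.1 hψ0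
  obtain ⟨ε, hε, hεδ, hεδ'⟩ : ∃ ε > 0, ε ≤ δ ∧ ε ≤ δ' :=
    ⟨min δ δ', lt_min hδ hδ', min_le_left _ _, min_le_right _ _⟩
  replace hball := fun p hp => hball p (Metric.ball_subset_ball hεδ hp)
  replace hball' := fun y hy => hball' y (Metric.ball_subset_ball hεδ' hy)
  have hdom : ∀ p ∈ Metric.ball (0 : ℂ × ℂ) ε, ‖p.1 / r‖ + ‖p.2 / s‖ < 1 :=
    fun p hp => (hball p hp).1
  have haxis : ∀ (l : ((ℕ × ℕ) →ᵇ ℂ) →L[ℂ] ℂ), ∀ y ∈ Metric.ball (0 : ℂ) ε,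
      l (primFst r (monomials r s (0, y))) = 0 := fun l y hy => by
    rw [primFst_monomials_of_fst_eq_zero (hdom (0, y) ?_) rfl, map_zero]
    rw [← Prod.mk_zero_zero, ← ball_prod_same]
    exact ⟨Metric.mem_ball_self hε, hy⟩
  let N : (((ℕ × ℕ) →ᵇ ℂ) →L[ℂ] ℂ) → Prop := fun l =>
    ∀ p ∈ Metric.ball (0 : ℂ × ℂ) ε, l (monomials r s p) = 0
  have hNQ : ∀ l, N l → N (l.comp Q) := by
    intro l hl p hp
    have h1 := eqOn_zero_of_fderiv_fst_eq_zero hε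
      (u := fun q => l (primFst r (monomials r s q)))
      (fun p hp => (hasFDerivAt_functional_primFst hr hs l (hdom p hp)).differentiableAt)
      (fun p hp => by
        rw [fderiv_functional_primFst hr hs l (hdom p hp), hl p hp]; simp)
      (haxis l)
    have h2 : (fun q => l (primFst r (monomials r s q))) =ᶠ[nhds p] fun _ => 0 := by
      filter_upwards [Metric.isOpen_ball.mem_nhds hp] with q hq using h1 q hq
    have h3 := fderiv_functional_primFst hr hs l (hdom p hp) (0, 1)
    rw [h2.fderiv_eq] at h3
    simp at h3
    rw [ContinuousLinearMap.comp_apply, hQdef, mul_apply_eq_comp, hMh p (hdom p hp), map_smul,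
      map_smul, ← h3, smul_zero]
  let l : ((ℕ × ℕ) →ᵇ ℂ) →L[ℂ] ℂ :=
    (BoundedContinuousFunction.evalCLM ℂ ((0, 0) : ℕ × ℕ) : ((ℕ × ℕ) →ᵇ ℂ) →L[ℂ] ℂ).comp Mw
  have hl : ∀ p ∈ Metric.ball (0 : ℂ × ℂ) ε, l (monomials r s p) = fderiv ℂ ψ p (1, 0) := by
    intro p hp
    simp [l, hMw p (hdom p hp), monomials_apply (hdom p hp)]
  have hrep : ∀ p ∈ Metric.ball (0 : ℂ × ℂ) ε, ψ p - l (primFst r (monomials r s p)) = 0 := by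
    refine eqOn_zero_of_fderiv_fst_eq_zero hε
      (u := fun p => ψ p - l (primFst r (monomials r s p))) (fun p hp => ?_) (fun p hp => ?_)
      (fun y hy => by rw [haxis l y hy, hball' y hy, sub_zero])
    · exact (hball p hp).2.2.differentiableAt.sub
        (hasFDerivAt_functional_primFst hr hs l (hdom p hp)).differentiableAt
    · rw [fderiv_fun_sub (hball p hp).2.2.differentiableAt
        (hasFDerivAt_functional_primFst hr hs l (hdom p hp)).differentiableAt,
        sub_apply, fderiv_functional_primFst hr hs l (hdom p hp), hl p hp]
      simp
  have hN : N (l.comp (1 + Q)) := by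
    intro p hp
    have h1 : ψ =ᶠ[nhds p] fun q => l (primFst r (monomials r s q)) := by
      filter_upwards [Metric.isOpen_ball.mem_nhds hp] with q hq using sub_eq_zero.1 (hrep q hq)
    have h2 := (hball p hp).2.1
    rw [h1.fderiv_eq, fderiv_functional_primFst hr hs l (hdom p hp)] at h2
    simp only [ContinuousLinearMap.comp_apply, add_apply,
      one_apply_eq_self, hQdef, mul_apply_eq_comp, hMh p (hdom p hp), map_smul,
      map_add, smul_eq_mul]
    simpa using h2
  have hNpow : ∀ n : ℕ, N (l.comp ((1 + Q) * Q ^ n)) := by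
    intro n
    induction n with
    | zero => simpa using hN
    | succ n ih =>
      have := hNQ _ ih
      rwa [ContinuousLinearMap.comp_assoc, ← ContinuousLinearMap.mul_def, mul_assoc, ← pow_succ]
        at this
  have hzero : ∀ p ∈ Metric.ball (0 : ℂ × ℂ) ε, l (monomials r s p) = 0 := by
    intro p hp
    have h1 : ∀ n : ℕ, ‖l ((Q ^ n) (monomials r s p))‖ = ‖l (monomials r s p)‖ := by
      intro n
      induction n with
      | zero => simp
      | succ n ih =>
        have h2 : l (((1 + Q) * Q ^ n) (monomials r s p)) = 0 := hNpow n p hp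
        rw [add_mul, one_mul, ← pow_succ', add_apply, map_add] at h2
        rw [← ih, eq_neg_of_add_eq_zero_right h2, norm_neg]
    have h3 := tendsto_pow_atTop_nhds_zero_of_norm_lt_one
      (R := ((ℕ × ℕ) →ᵇ ℂ) →L[ℂ] ((ℕ × ℕ) →ᵇ ℂ)) hQ
    have h4 := (((l.comp (ContinuousLinearMap.apply ℂ ((ℕ × ℕ) →ᵇ ℂ)
      (monomials r s p))).continuous.tendsto 0).comp h3).norm
    rw [map_zero, norm_zero] at h4
    exact norm_eq_zero.1 (tendsto_nhds_unique (tendsto_const_nhds.congr fun n => (h1 n).symm) h4)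
  have hfin := eqOn_zero_of_fderiv_fst_eq_zero hε (u := ψ)
    (fun p hp => (hball p hp).2.2.differentiableAt)
    (fun p hp => (hl p hp).symm.trans (hzero p hp)) hball'
  filter_upwards [Metric.ball_mem_nhds _ hε] with p hp using hfin p hp

lemma det_fderiv_ne_zero {φ : ℂ × ℂ → ℂ} (hφ : DifferentiableAt ℂ φ 0)
    (h : fderiv ℂ φ 0 (1, 0) ≠ 0) :
    LinearMap.det ((fderiv ℂ (fun p : ℂ × ℂ => (φ p, p.2)) 0).toLinearMap) ≠ 0 := by
  rw [(hφ.hasFDerivAt.prodMk hasFDerivAt_snd).fderiv]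
  rw [ne_eq, LinearMap.det_eq_zero_iff_ker_ne_bot, not_not, LinearMap.ker_eq_bot']
  rintro ⟨a, b⟩ hab
  simp only [ContinuousLinearMap.coe_coe, ContinuousLinearMap.prod_apply,
    ContinuousLinearMap.coe_snd', Prod.mk_eq_zero] at hab
  obtain ⟨h1, rfl⟩ := hab
  have h2 : ((a, 0) : ℂ × ℂ) = a • ((1, 0) : ℂ × ℂ) := by simp
  rw [h2, map_smul, smul_eq_mul] at h1
  simpa using (mul_eq_zero.1 h1).resolve_right h

lemma fderiv_graph_eq_iff {φ : ℂ × ℂ → ℂ} {p : ℂ × ℂ} (hφ : DifferentiableAt ℂ φ p) (a b : ℂ) :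
    fderiv ℂ (fun q : ℂ × ℂ => (φ q, q.2)) p (a, b) = (1, b) ↔ fderiv ℂ φ p (a, b) = 1 := by
  rw [(hφ.hasFDerivAt.prodMk hasFDerivAt_snd).fderiv]
  simp [Prod.ext_iff]

lemma fderiv_eq_one_iff {φ : ℂ × ℂ → ℂ} {p : ℂ × ℂ} {a : ℂ} (ha : a ≠ 0) (b : ℂ) :
    fderiv ℂ φ p (a, b) = 1 ↔ fderiv ℂ φ p (1, b * a⁻¹) = a⁻¹ := by
  have : ((a, b) : ℂ × ℂ) = a • ((1, b * a⁻¹) : ℂ × ℂ) := by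
    simp; field_simp
  rw [this, map_smul, smul_eq_mul]
  exact ⟨eq_inv_of_mul_eq_one_right, fun h => by rw [h, mul_inv_cancel₀ ha]⟩

lemma eventually_eq_integral {u v : ℂ → ℂ} (hv : AnalyticAt ℂ v 0) (hu0 : u 0 = 0)
    (hu : ∀ᶠ x in nhds (0 : ℂ), HasDerivAt u (v x) x) :
    ∀ᶠ x in nhds (0 : ℂ), u x = ∫ t in (0 : ℝ)..1, x * v ((t : ℂ) * x) := by
  obtain ⟨δ, hδ, hball⟩ := Metric.eventually_nhds_iff_ball.1 (hu.and hv.eventually_analyticAt)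
  filter_upwards [Metric.ball_mem_nhds _ hδ] with x hx
  have hmem : ∀ t ∈ Set.uIcc (0 : ℝ) 1, (t : ℂ) * x ∈ Metric.ball (0 : ℂ) δ := by
    intro t ht
    rw [Set.uIcc_of_le zero_le_one] at ht
    rw [mem_ball_zero_iff] at hx ⊢
    rw [norm_mul, Complex.norm_real, Real.norm_of_nonneg ht.1]
    exact (mul_le_of_le_one_left (norm_nonneg _) ht.2).trans_lt hx
  have hmul : ∀ t : ℝ, HasDerivAt (fun t : ℝ => (t : ℂ) * x) x t := fun t => by
    simpa using (Complex.ofRealCLM.hasDerivAt (x := t)).mul_const x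
  have hder : ∀ t ∈ Set.uIcc (0 : ℝ) 1,
      HasDerivAt (fun t : ℝ => u ((t : ℂ) * x)) (x * v ((t : ℂ) * x)) t := fun t ht => by
    have h := (hball _ (hmem t ht)).1.scomp t (hmul t)
    rw [smul_eq_mul] at h
    exact h
  have hint : IntervalIntegrable (fun t : ℝ => x * v ((t : ℂ) * x)) MeasureTheory.volume 0 1 := by
    refine ContinuousOn.intervalIntegrable fun t ht => ?_
    have h1 : ContinuousAt (fun t : ℝ => v ((t : ℂ) * x)) t :=
      ContinuousAt.comp (f := fun t : ℝ => (t : ℂ) * x)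
        (hball _ (hmem t ht)).2.continuousAt (hmul t).continuousAt
    exact (continuousAt_const.mul h1).continuousWithinAt
  rw [intervalIntegral.integral_eq_sub_of_hasDerivAt hder hint]
  simp [hu0]

/-- **Gluing Lemma (vector fields), local normalization.**
For `X = f(x,y)∂x + yᵏ∂y` with `f(0,0) ≠ 0` and the model `X₀ = ∂x + yᵏ∂y`,
there is a unique holomorphic `φ` near `0` with `φ(0,y) = 0` such that
`Φ(x,y) = (φ(x,y), y)` is a local biholomorphism conjugating `X` to `X₀`
(`DΦ(p)·X(p) = X₀(Φ(p))`).  Moreover `φ(x,0) = ∫₀ˣ dζ/f(ζ,0)` (written as an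
integral over the segment from `0` to `x`), and `Φ` restricts to the identity on
the horizontal axis iff `f(·,0) ≡ 1`. -/
theorem gluing_lemma_vector_field (k : ℕ) (hk : 1 ≤ k)
    (f : ℂ × ℂ → ℂ) (hf : AnalyticAt ℂ f 0) (hf0 : f 0 ≠ 0) :
    ∃ φ : ℂ × ℂ → ℂ, AnalyticAt ℂ φ 0 ∧
      (∀ᶠ y in nhds (0 : ℂ), φ (0, y) = 0) ∧
      LinearMap.det ((fderiv ℂ (fun p : ℂ × ℂ => (φ p, p.2)) 0).toLinearMap) ≠ 0 ∧
      (∀ᶠ p in nhds (0 : ℂ × ℂ),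
        fderiv ℂ (fun q : ℂ × ℂ => (φ q, q.2)) p (f p, p.2 ^ k) = (1, p.2 ^ k)) ∧
      (∀ φ' : ℂ × ℂ → ℂ, AnalyticAt ℂ φ' 0 →
        (∀ᶠ y in nhds (0 : ℂ), φ' (0, y) = 0) →
        LinearMap.det ((fderiv ℂ (fun p : ℂ × ℂ => (φ' p, p.2)) 0).toLinearMap) ≠ 0 →
        (∀ᶠ p in nhds (0 : ℂ × ℂ),
          fderiv ℂ (fun q : ℂ × ℂ => (φ' q, q.2)) p (f p, p.2 ^ k) = (1, p.2 ^ k)) →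
        φ' =ᶠ[nhds (0 : ℂ × ℂ)] φ) ∧
      (∀ᶠ x in nhds (0 : ℂ), φ (x, 0) = ∫ t in (0:ℝ)..1, x / f ((t : ℂ) * x, 0)) ∧
      ((∀ᶠ x in nhds (0 : ℂ), φ (x, 0) = x) ↔ ∀ᶠ x in nhds (0 : ℂ), f (x, 0) = 1) := by
  have hfi : AnalyticAt ℂ (fun p => (f p)⁻¹) 0 := hf.inv hf0
  have hh : AnalyticAt ℂ (fun p : ℂ × ℂ => p.2 ^ k * (f p)⁻¹) 0 := (analyticAt_snd.pow k).mul hfi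
  have hne : ∀ᶠ p in nhds (0 : ℂ × ℂ), f p ≠ 0 := hf.continuousAt.eventually_ne hf0
  have hk0 : k ≠ 0 := by omega
  have hpde_iff : ∀ φ : ℂ × ℂ → ℂ, AnalyticAt ℂ φ 0 →
      ((∀ᶠ p in nhds (0 : ℂ × ℂ),
        fderiv ℂ (fun q : ℂ × ℂ => (φ q, q.2)) p (f p, p.2 ^ k) = (1, p.2 ^ k)) ↔
      ∀ᶠ p in nhds (0 : ℂ × ℂ), fderiv ℂ φ p (1, p.2 ^ k * (f p)⁻¹) = (f p)⁻¹) := by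
    intro φ hφ
    refine eventually_congr ?_
    filter_upwards [hne, hφ.eventually_analyticAt] with p hp hφp
    rw [fderiv_graph_eq_iff hφp.differentiableAt, fderiv_eq_one_iff hp]
  obtain ⟨φ, hφ, hφ0, hφpde⟩ := exists_analytic_solution hfi hh
  have hc : ContinuousAt (fun x : ℂ => ((x, 0) : ℂ × ℂ)) 0 := by fun_prop
  have hder : ∀ᶠ x in nhds (0 : ℂ), HasDerivAt (fun x => φ (x, 0)) ((f (x, 0))⁻¹) x := by
    filter_upwards [hc.eventually hφpde, hc.eventually hφ.eventually_analyticAt] with x hx hφx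
    have := HasFDerivAt.comp_hasDerivAt x hφx.differentiableAt.hasFDerivAt
      ((hasDerivAt_id x).prodMk (hasDerivAt_const x (0 : ℂ)))
    simp only [zero_pow hk0, zero_mul] at hx
    rwa [hx] at this
  have hint : ∀ᶠ x in nhds (0 : ℂ), φ (x, 0) = ∫ t in (0:ℝ)..1, x / f ((t : ℂ) * x, 0) := by
    simp only [div_eq_mul_inv]
    exact eventually_eq_integral (v := fun x => (f (x, 0))⁻¹) hfi.curry_left hφ0.self_of_nhds hder
  refine ⟨φ, hφ, hφ0, ?_, (hpde_iff φ hφ).2 hφpde, ?_, hint, ?_, ?_⟩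
  · refine det_fderiv_ne_zero hφ.differentiableAt ?_
    have := hφpde.self_of_nhds
    simp only [Prod.snd_zero, zero_pow hk0, zero_mul] at this
    rw [this]
    exact inv_ne_zero hf0
  · intro φ' hφ' hφ'0 _ hφ'pde
    have h1 : ∀ᶠ p in nhds (0 : ℂ × ℂ), (φ' - φ) p = 0 := by
      refine eventually_eq_zero_of_analytic_solution hh (hφ'.sub hφ) ?_ ?_
      · filter_upwards [hφ0, hφ'0] with y h1 h2
        simp [h1, h2]
      · filter_upwards [hφpde, (hpde_iff φ' hφ').1 hφ'pde, hφ.eventually_analyticAt,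
          hφ'.eventually_analyticAt] with p h1 h2 h3 h4
        rw [fderiv_sub h4.differentiableAt h3.differentiableAt, sub_apply, h1, h2, sub_self]
    filter_upwards [h1] with p hp using sub_eq_zero.1 hp
  · intro hid
    filter_upwards [hid.eventually_nhds, hder] with x hx hdx
    have h1 : (fun x => φ (x, 0)) =ᶠ[nhds x] id := hx
    have h2 := hdx.unique ((hasDerivAt_id x).congr_of_eventuallyEq h1)
    exact inv_eq_one.1 h2
  · intro hf1
    obtain ⟨δ, hδ, hball⟩ := Metric.eventually_nhds_iff_ball.1 hf1
    filter_upwards [hint, Metric.ball_mem_nhds _ hδ] with x hx hxδ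
    rw [hx]
    have h1 : Set.EqOn (fun t : ℝ => x / f ((t : ℂ) * x, 0)) (fun _ => x) (Set.uIcc 0 1) := by
      intro t ht
      rw [Set.uIcc_of_le zero_le_one] at ht
      have h2 : (t : ℂ) * x ∈ Metric.ball (0 : ℂ) δ := by
        rw [mem_ball_zero_iff] at hxδ ⊢
        rw [norm_mul, Complex.norm_real, Real.norm_of_nonneg ht.1]
        exact (mul_le_of_le_one_left (norm_nonneg _) ht.2).trans_lt hxδ
      change x / f ((t : ℂ) * x, 0) = x
      rw [hball _ h2, div_one]
    rw [intervalIntegral.integral_congr h1]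
    simp
end

section
/- Let Ω ⊂ ℂ be a connected open set, and let f, f', u be holomorphic and nowhere vanishing on a neighborhood U of Ω×{0} in ℂ². Set X = f(x,y)∂x + y∂y and X' = f'(x,y)∂x + y∂y. Suppose there exist holomorphic functions φ on a neighborhood of Ω×{0} and ψ on a neighborhood of 0 ∈ ℂ with ψ(0) = 0 and ψ'(0) ≠ 0, such that the map Φ(x,y) = (x + y·φ(x,y), ψ(y)) satisfies DΦ(p)·X(p) = u(p)·X'(Φ(p)) for all p in a neighborhood of Ω×{0}. Then f(x,0) = f'(x,0) for every x ∈ Ω. -/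
open Filter

/-- The derivative of `(x, y) ↦ (x + y φ(x, y), ψ(y))` applied to a vector. -/
theorem fderiv_add_mul_prodMk_apply {φ : ℂ × ℂ → ℂ} {ψ : ℂ → ℂ} {p : ℂ × ℂ}
    (hφ : DifferentiableAt ℂ φ p) (hψ : DifferentiableAt ℂ ψ p.2) (v : ℂ × ℂ) :
    fderiv ℂ (fun q : ℂ × ℂ => (q.1 + q.2 * φ q, ψ q.2)) p v
      = (v.1 + (p.2 * fderiv ℂ φ p v + φ p * v.2), deriv ψ p.2 * v.2) := by
  have h₁ : HasFDerivAt (fun q : ℂ × ℂ => q.1) (ContinuousLinearMap.fst ℂ ℂ ℂ) p :=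
    hasFDerivAt_fst
  have h₂ : HasFDerivAt (fun q : ℂ × ℂ => q.2) (ContinuousLinearMap.snd ℂ ℂ ℂ) p :=
    hasFDerivAt_snd
  have h := (h₁.add (h₂.mul hφ.hasFDerivAt)).prodMk (hψ.hasDerivAt.comp_hasFDerivAt p h₂)
  exact (congrArg (fun L : ℂ × ℂ →L[ℂ] ℂ × ℂ => L v) h.fderiv).trans (by simp)

/-- If `ψ'(y) y = g(y) ψ(y)` near a simple zero `0` of `ψ`, then `g(0) = 1`. -/
theorem eq_one_of_deriv_mul_eventuallyEq {g ψ : ℂ → ℂ} (hg : DifferentiableAt ℂ g 0)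
    (hψ : AnalyticAt ℂ ψ 0) (hψ0 : ψ 0 = 0) (hψ' : deriv ψ 0 ≠ 0)
    (h : ∀ᶠ y in nhds 0, deriv ψ y * y = g y * ψ y) : g 0 = 1 := by
  have h₁ := hψ.deriv.differentiableAt.hasDerivAt.mul (hasDerivAt_id (0 : ℂ))
  have h₂ := hg.hasDerivAt.mul hψ.differentiableAt.hasDerivAt
  have h₃ := h₁.unique (h₂.congr_of_eventuallyEq h)
  simp only [id, mul_zero, mul_one, zero_add, hψ0] at h₃
  exact mul_right_cancel₀ hψ' (by rw [one_mul, ← h₃])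

/-- **Gluing Lemma along a common leaf, necessity (contact order `k = 1`).**
If `X = f∂x + y∂y` and `X' = f'∂x + y∂y` are holomorphic near `Ω × {0}` with
`f, f'` nowhere vanishing, and a map `Φ(x,y) = (x + y·φ(x,y), ψ(y))` (with
`ψ(0) = 0`, `ψ'(0) ≠ 0`) conjugates the foliation of `X` to that of `X'`
(`DΦ(p)·X(p) = u(p)·X'(Φ(p))` with `u` nonvanishing) near `Ω × {0}`, then
`f(x,0) = f'(x,0)` for all `x ∈ Ω`. -/
theorem gluing_lemma_common_leaf_necessary
    (Ω : Set ℂ) (hΩo : IsOpen Ω) (hΩc : IsConnected Ω)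
    (U : Set (ℂ × ℂ)) (hUo : IsOpen U) (hUΩ : Ω ×ˢ ({0} : Set ℂ) ⊆ U)
    (f f' u : ℂ × ℂ → ℂ)
    (hf : AnalyticOnNhd ℂ f U) (hf' : AnalyticOnNhd ℂ f' U) (hu : AnalyticOnNhd ℂ u U)
    (hfz : ∀ p ∈ U, f p ≠ 0) (hf'z : ∀ p ∈ U, f' p ≠ 0) (huz : ∀ p ∈ U, u p ≠ 0)
    (φ : ℂ × ℂ → ℂ) (ψ : ℂ → ℂ)
    (V : Set (ℂ × ℂ)) (hVo : IsOpen V) (hVΩ : Ω ×ˢ ({0} : Set ℂ) ⊆ V) (hVU : V ⊆ U)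
    (hφ : AnalyticOnNhd ℂ φ V)
    (hψ : AnalyticAt ℂ ψ 0) (hψ0 : ψ 0 = 0) (hψ' : deriv ψ 0 ≠ 0)
    (hconj : ∀ p ∈ V,
      fderiv ℂ (fun q : ℂ × ℂ => (q.1 + q.2 * φ q, ψ q.2)) p (f p, p.2)
        = u p • ((f' (p.1 + p.2 * φ p, ψ p.2), ψ p.2) : ℂ × ℂ)) :
    ∀ x ∈ Ω, f (x, 0) = f' (x, 0) := by
  intro x hx
  have hxV : (x, (0 : ℂ)) ∈ V := hVΩ ⟨hx, rfl⟩
  have hcont : ContinuousAt (fun y : ℂ => (x, y)) 0 := by fun_prop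
  have hu1 : u (x, 0) = 1 := by
    refine eq_one_of_deriv_mul_eventuallyEq (g := fun y => u (x, y)) ?_ hψ hψ0 hψ' ?_
    · exact (hu _ (hVU hxV)).differentiableAt.comp (0 : ℂ)
        (f := fun y : ℂ => (x, y)) (by fun_prop)
    · filter_upwards [hcont.eventually (hVo.mem_nhds hxV), hψ.eventually_analyticAt]
        with y hy hψy
      have h := hconj _ hy
      rw [fderiv_add_mul_prodMk_apply (hφ _ hy).differentiableAt hψy.differentiableAt] at h
      simpa using congrArg Prod.snd h
  have h := hconj _ hxV
  rw [fderiv_add_mul_prodMk_apply (hφ _ hxV).differentiableAt hψ.differentiableAt] at h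
  simpa [hu1, hψ0] using congrArg Prod.fst h
end

section
/- Let Ω ⊂ ℂ be a simply connected open set, k ≥ 1 an integer, and let f, f' be holomorphic and nowhere vanishing on a neighborhood of Ω×{0} in ℂ². Set X = f(x,y)∂x + y^k∂y and X' = f'(x,y)∂x + y^k∂y, and assume f(x,0) = f'(x,0) for all x ∈ Ω. Then there exist a neighborhood W of Ω×{0} and a holomorphic function φ on W such that the map Φ(x,y) = (x + y·φ(x,y), y) is injective on W, fixes Ω×{0} pointwise, and satisfies DΦ(p)·X(p) = X'(Φ(p)) for all p ∈ W. -/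
open Filter

open Set Metric Topology in
/-- Integration over a circle as a continuous linear functional on the continuous functions
on that circle. -/
theorem exists_circleIntegral_clm (b : ℂ) {r : ℝ} (hr : 0 < r) :
    ∃ I : C(sphere b r, ℂ) →L[ℂ] ℂ, ∀ (h : C(sphere b r, ℂ)) (F : ℂ → ℂ),
      (∀ w : sphere b r, F w = h w) → I h = ∮ w in C(b, r), F w := by
  classical
  let ext : C(sphere b r, ℂ) → ℂ → ℂ := fun h w => if hw : w ∈ sphere b r then h ⟨w, hw⟩ else 0
  have hext : ∀ (h : C(sphere b r, ℂ)) (w : sphere b r), ext h w = h w := fun h w => by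
    simp only [ext]; rw [dif_pos w.2]
  have hci : ∀ h : C(sphere b r, ℂ), CircleIntegrable (ext h) b r := fun h => by
    apply ContinuousOn.circleIntegrable hr.le
    rw [continuousOn_iff_continuous_domRestrict]
    refine h.continuous.congr fun w => (hext h w).symm
  refine ⟨LinearMap.mkContinuous
    { toFun := fun h => ∮ w in C(b, r), ext h w
      map_add' := fun g h => by
        rw [← circleIntegral.integral_add (hci g) (hci h)]
        refine circleIntegral.integral_congr hr.le fun w hw => ?_
        simp only [hext (g + h) ⟨w, hw⟩, hext g ⟨w, hw⟩, hext h ⟨w, hw⟩, ContinuousMap.add_apply]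
      map_smul' := fun c h => by
        rw [RingHom.id_apply, ← circleIntegral.integral_smul]
        refine circleIntegral.integral_congr hr.le fun w hw => ?_
        simp [ext] } (2 * Real.pi * r) fun h => ?_, fun h F hF => ?_⟩
  · change ‖∮ w in C(b, r), ext h w‖ ≤ _
    refine circleIntegral.norm_integral_le_of_norm_le_const hr.le fun w hw => ?_
    rw [hext h ⟨w, hw⟩]
    exact h.norm_coe_le_norm _
  · change (∮ w in C(b, r), ext h w) = _
    refine circleIntegral.integral_congr hr.le fun w hw => ?_
    rw [hF ⟨w, hw⟩, hext h ⟨w, hw⟩]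

open Set Metric Topology in
/-- **Osgood's lemma** in two variables. -/
theorem analyticOnNhd_of_continuousOn_of_separately {f : ℂ × ℂ → ℂ} {V : Set (ℂ × ℂ)}
    (hV : IsOpen V) (hc : ContinuousOn f V)
    (h1 : ∀ p ∈ V, DifferentiableAt ℂ (fun x => f (x, p.2)) p.1)
    (h2 : ∀ p ∈ V, DifferentiableAt ℂ (fun y => f (p.1, y)) p.2) :
    AnalyticOnNhd ℂ f V := by
  classical
  rintro ⟨a, b⟩ hp
  obtain ⟨r, hr, hrV⟩ := nhds_basis_closedBall.mem_iff.1 (hV.mem_nhds hp)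
  rw [← closedBall_prod_same] at hrV
  have hmem : ∀ {x y}, x ∈ closedBall a r → y ∈ closedBall b r → (x, y) ∈ V :=
    fun hx hy => hrV ⟨hx, hy⟩
  obtain ⟨I, hI⟩ := exists_circleIntegral_clm b hr
  let c : C(closedBall a r × sphere b r, ℂ) :=
    ⟨fun q => f (q.1, q.2), hc.comp_continuous (by fun_prop) fun q =>
      hmem q.1.2 (sphere_subset_closedBall q.2.2)⟩
  let F : ℂ → C(sphere b r, ℂ) := fun z => if hz : z ∈ closedBall a r then c.curry ⟨z, hz⟩ else 0
  have hF : ∀ (z) (_ : z ∈ closedBall a r) (w : sphere b r), F z w = f (z, w) := fun z hz w => by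
    simp only [F]; rw [dif_pos hz]; rfl
  have hFc : ContinuousOn F (closedBall a r) := by
    rw [continuousOn_iff_continuous_domRestrict]
    refine c.curry.continuous.congr fun z => ?_
    simp only [domRestrict_apply, F]; rw [dif_pos z.2]
  have hFs : ContinuousOn F (sphere a r) := hFc.mono sphere_subset_closedBall
  let G : ℂ → C(sphere b r, ℂ) := fun x =>
    (2 * Real.pi * Complex.I : ℂ)⁻¹ • ∮ z in C(a, r), (z - x)⁻¹ • F z
  have hG : AnalyticAt ℂ G a := by
    have := hasFPowerSeriesOn_cauchy_integral (f := F) (c := a) (R := ⟨r, hr.le⟩)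
      (hFs.circleIntegrable hr.le) hr
    exact this.analyticAt
  have hpi : (2 * Real.pi * Complex.I : ℂ) ≠ 0 := Complex.two_pi_I_ne_zero
  have hGf : ∀ x ∈ ball a r, ∀ w : sphere b r, G x w = f (x, w) := fun x hx w => by
    have hint : CircleIntegrable (fun z => (z - x)⁻¹ • F z) a r := by
      refine ContinuousOn.circleIntegrable hr.le (ContinuousOn.fun_smul ?_ hFs)
      refine ContinuousOn.inv₀ (by fun_prop) fun z hz => ?_
      rw [sub_ne_zero]
      rintro rfl
      exact (mem_ball.1 hx).ne (mem_sphere.1 hz)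
    have h3 : (ContinuousMap.evalCLM ℂ w) (∮ z in C(a, r), (z - x)⁻¹ • F z)
        = ∮ z in C(a, r), (z - x)⁻¹ • f (z, w) := by
      rw [circleIntegral, ← ContinuousLinearMap.intervalIntegral_comp_comm _ hint.out,
        circleIntegral]
      refine intervalIntegral.integral_congr fun θ _ => ?_
      simp only [map_smul]
      congr 2
      exact hF _ (circleMap_mem_closedBall a hr.le θ) w
    have h4 : DifferentiableOn ℂ (fun z => f (z, (w : ℂ))) (closedBall a r) := fun z hz =>
      (h1 (z, w) (hmem hz (sphere_subset_closedBall w.2))).differentiableWithinAt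
    rw [h4.circleIntegral_sub_inv_smul hx] at h3
    change (ContinuousMap.evalCLM ℂ w) ((2 * Real.pi * Complex.I : ℂ)⁻¹ • _) = _
    rw [map_smul, h3, smul_smul, inv_mul_cancel₀ hpi, one_smul]
  let ι : C(sphere b r, ℂ) := ⟨fun w => w, by fun_prop⟩
  have hne : ∀ y ∈ ball b r, ∀ w : sphere b r, (w : ℂ) - y ≠ 0 := fun y hy w => by
    rw [sub_ne_zero]
    rintro h
    exact (mem_ball.1 hy).ne (h ▸ mem_sphere.1 w.2)
  let k : ℂ → C(sphere b r, ℂ) := fun y => Ring.inverse (ι - algebraMap ℂ _ y)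
  have hk : ∀ (y) (hy : y ∈ ball b r), IsUnit (ι - algebraMap ℂ C(sphere b r, ℂ) y) ∧
      ∀ w, k y w = ((w : ℂ) - y)⁻¹ := fun y hy => by
    let u : C(sphere b r, ℂ) := ⟨fun w => ((w : ℂ) - y)⁻¹,
      Continuous.inv₀ (by fun_prop) fun w => hne y hy w⟩
    have hu : (ι - algebraMap ℂ C(sphere b r, ℂ) y) * u = 1 := by
      ext w
      exact mul_inv_cancel₀ (hne y hy w)
    refine ⟨IsUnit.of_mul_eq_one _ hu, fun w => ?_⟩
    have : k y = u := by
      simp only [k]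
      exact Ring.inverse_unit (Units.mkOfMulEqOne _ u hu)
    rw [this]; rfl
  have hka : AnalyticAt ℂ k b := by
    obtain ⟨v, hv⟩ := (hk b (mem_ball_self hr)).1
    have h5 : AnalyticAt ℂ Ring.inverse (ι - algebraMap ℂ C(sphere b r, ℂ) b) := by
      rw [← hv]; exact analyticAt_inverse v
    refine AnalyticAt.fun_comp (g := Ring.inverse) (f := fun y => ι - algebraMap ℂ _ y) h5 ?_
    exact analyticAt_const.sub
      ((Algebra.linearMap ℂ C(sphere b r, ℂ)).toContinuousLinearMap.analyticAt b)
  have hfin : AnalyticAt ℂ (fun p : ℂ × ℂ =>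
      (2 * Real.pi * Complex.I : ℂ)⁻¹ * I (k p.2 * G p.1)) (a, b) := by
    refine analyticAt_const.mul ((I.analyticAt _).fun_comp (AnalyticAt.mul ?_ ?_))
    · exact AnalyticAt.fun_comp (f := fun p : ℂ × ℂ => p.2) hka analyticAt_snd
    · exact AnalyticAt.fun_comp (f := fun p : ℂ × ℂ => p.1) hG analyticAt_fst
  refine hfin.congr ?_
  have hnb : ball a r ×ˢ ball b r ∈ 𝓝 (a, b) :=
    prod_mem_nhds (ball_mem_nhds _ hr) (ball_mem_nhds _ hr)
  filter_upwards [hnb] with ⟨x, y⟩ ⟨hx, hy⟩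
  simp only at hx hy ⊢
  rw [hI _ (fun w => (w - y)⁻¹ • f (x, w)) fun w => by
    simp [(hk y hy).2, hGf x hx]]
  have h6 : DifferentiableOn ℂ (fun w => f (x, w)) (closedBall b r) := fun w hw =>
    (h2 (x, w) (hmem (ball_subset_closedBall hx) hw)).differentiableWithinAt
  rw [h6.circleIntegral_sub_inv_smul hy, smul_eq_mul, ← mul_assoc, inv_mul_cancel₀ hpi, one_mul]

open Set Metric Topology in
theorem DifferentiableOn.analyticOnNhd_prod {f : ℂ × ℂ → ℂ} {V : Set (ℂ × ℂ)}
    (hV : IsOpen V) (hf : DifferentiableOn ℂ f V) : AnalyticOnNhd ℂ f V := by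
  have hd : ∀ p ∈ V, DifferentiableAt ℂ f p := fun p hp => hf.differentiableAt (hV.mem_nhds hp)
  refine analyticOnNhd_of_continuousOn_of_separately hV hf.continuousOn (fun p hp => ?_)
    fun p hp => ?_
  · exact DifferentiableAt.comp (g := f) p.1 (hd p hp) (by fun_prop)
  · exact DifferentiableAt.comp (g := f) p.2 (hd p hp) (by fun_prop)

open Set Metric Topology in
/-- Weierstrass' theorem in two variables. -/
theorem TendstoUniformlyOn.analyticOnNhd_prod {F : ℕ → ℂ × ℂ → ℂ} {f : ℂ × ℂ → ℂ}
    {V : Set (ℂ × ℂ)} (hV : IsOpen V) (h : TendstoUniformlyOn F f atTop V)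
    (hF : ∀ n, AnalyticOnNhd ℂ (F n) V) : AnalyticOnNhd ℂ f V := by
  refine analyticOnNhd_of_continuousOn_of_separately hV
    (h.continuousOn (Frequently.of_forall fun n => (hF n).continuousOn)) (fun p hp => ?_)
    fun p hp => ?_
  · have ho : IsOpen ((fun x : ℂ => (x, p.2)) ⁻¹' V) := hV.preimage (by fun_prop)
    refine DifferentiableOn.differentiableAt ?_ (ho.mem_nhds hp)
    refine (h.comp (fun x : ℂ => (x, p.2))).tendstoLocallyUniformlyOn.differentiableOn
      (Eventually.of_forall fun n x hx => ?_) ho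
    exact (((hF n) _ hx).differentiableAt.comp x (by fun_prop)).differentiableWithinAt
  · have ho : IsOpen ((fun y : ℂ => (p.1, y)) ⁻¹' V) := hV.preimage (by fun_prop)
    refine DifferentiableOn.differentiableAt ?_ (ho.mem_nhds hp)
    refine (h.comp (fun y : ℂ => (p.1, y))).tendstoLocallyUniformlyOn.differentiableOn
      (Eventually.of_forall fun n x hx => ?_) ho
    exact (((hF n) _ hx).differentiableAt.comp x (by fun_prop)).differentiableWithinAt

/-- The linear map `(x, y) ↦ (x, τ y)`. -/
noncomputable def radialMap (τ : ℝ) : ℂ × ℂ →L[ℂ] ℂ × ℂ :=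
  (ContinuousLinearMap.inl ℂ ℂ ℂ).comp (ContinuousLinearMap.fst ℂ ℂ ℂ) +
    (τ : ℂ) • (ContinuousLinearMap.inr ℂ ℂ ℂ).comp (ContinuousLinearMap.snd ℂ ℂ ℂ)

theorem radialMap_apply (τ : ℝ) (v : ℂ × ℂ) : radialMap τ v = (v.1, (τ : ℂ) * v.2) := by
  simp [radialMap]

open Set Metric Topology in
theorem hasFDerivAt_radial_integral {g : ℂ × ℂ → ℂ} {V : Set (ℂ × ℂ)} (hV : IsOpen V)
    (hstar : ∀ p ∈ V, ∀ τ ∈ Icc (0 : ℝ) 1, (p.1, (τ : ℂ) * p.2) ∈ V)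
    (hg : AnalyticOnNhd ℂ g V) {p : ℂ × ℂ} (hp : p ∈ V) :
    HasFDerivAt (fun p : ℂ × ℂ => ∫ τ in (0 : ℝ)..1, g (p.1, (τ : ℂ) * p.2))
      (∫ τ in (0 : ℝ)..1, (fderiv ℂ g (p.1, (τ : ℂ) * p.2)).comp
        (radialMap τ)) p ∧
    ContinuousOn (fun τ : ℝ => fderiv ℂ g (p.1, (τ : ℂ) * p.2)) (Icc 0 1) := by
  obtain ⟨r, hr, hrV⟩ := nhds_basis_closedBall.mem_iff.1 (hV.mem_nhds hp)
  have hmaps : MapsTo (fun q : (ℂ × ℂ) × ℝ => (q.1.1, (q.2 : ℂ) * q.1.2))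
      (closedBall p r ×ˢ Icc (0 : ℝ) 1) V := fun q hq => hstar _ (hrV hq.1) _ hq.2
  have hφ : Continuous (fun q : (ℂ × ℂ) × ℝ => (q.1.1, (q.2 : ℂ) * q.1.2)) := by fun_prop
  have hgc := hg.continuousOn.comp hφ.continuousOn hmaps
  have hdc := hg.fderiv.continuousOn.comp hφ.continuousOn hmaps
  have hFc : ContinuousOn (fun q : (ℂ × ℂ) × ℝ => (fderiv ℂ g (q.1.1, (q.2 : ℂ) * q.1.2)).comp
        (radialMap q.2))
      (closedBall p r ×ˢ Icc (0 : ℝ) 1) := by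
    refine ContinuousOn.clm_comp hdc (Continuous.continuousOn ?_)
    unfold radialMap
    fun_prop
  obtain ⟨C, hC⟩ := ((isCompact_closedBall p r).prod isCompact_Icc).exists_bound_of_continuousOn hFc
  have hslice : ∀ q ∈ closedBall p r, MapsTo (fun τ : ℝ => (q, τ)) (Icc 0 1)
      (closedBall p r ×ˢ Icc (0 : ℝ) 1) := fun q hq τ hτ => ⟨hq, hτ⟩
  have hsub : uIoc (0 : ℝ) 1 ⊆ Icc 0 1 := by
    rw [uIoc_of_le zero_le_one]; exact Ioc_subset_Icc_self
  have hpm := mem_closedBall_self hr.le (x := p)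
  refine ⟨?_, hdc.comp (by fun_prop) (hslice p hpm)⟩
  refine intervalIntegral.hasFDerivAt_integral_of_dominated_of_fderiv_le
    (𝕜 := ℂ) (μ := MeasureTheory.volume) (F := fun p τ => g (p.1, (τ : ℂ) * p.2))
    (F' := fun p τ => (fderiv ℂ g (p.1, (τ : ℂ) * p.2)).comp (radialMap τ))
    (s := closedBall p r) (bound := fun _ => C) (closedBall_mem_nhds p hr) ?_ ?_ ?_ ?_
    intervalIntegrable_const ?_
  · filter_upwards [closedBall_mem_nhds p hr] with q hq
    exact ((hgc.comp (by fun_prop) (hslice q hq)).mono hsub).aestronglyMeasurable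
      measurableSet_uIoc
  · apply ContinuousOn.intervalIntegrable
    rw [uIcc_of_le zero_le_one]
    exact hgc.comp (by fun_prop) (hslice p hpm)
  · exact ((hFc.comp (by fun_prop) (hslice p hpm)).mono hsub).aestronglyMeasurable
      measurableSet_uIoc
  · exact Eventually.of_forall fun τ hτ q hq => hC (q, τ) ⟨hq, hsub hτ⟩
  · refine Eventually.of_forall fun τ hτ q hq => ?_
    have h1 := (hg _ (hmaps (show (q, τ) ∈ _ from ⟨hq, hsub hτ⟩))).differentiableAt.hasFDerivAt
    refine h1.comp q ((hasFDerivAt_fst.prodMk (hasFDerivAt_snd.const_mul (τ : ℂ))).congr_fderiv ?_)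
    ext <;> simp [radialMap]

open Set Metric Topology in
theorem analyticOnNhd_radial_integral {g : ℂ × ℂ → ℂ} {V : Set (ℂ × ℂ)} (hV : IsOpen V)
    (hstar : ∀ p ∈ V, ∀ τ ∈ Icc (0 : ℝ) 1, (p.1, (τ : ℂ) * p.2) ∈ V)
    (hg : AnalyticOnNhd ℂ g V) :
    AnalyticOnNhd ℂ (fun p : ℂ × ℂ => ∫ τ in (0 : ℝ)..1, g (p.1, (τ : ℂ) * p.2)) V :=
  DifferentiableOn.analyticOnNhd_prod hV fun _ hp =>
    (hasFDerivAt_radial_integral hV hstar hg hp).1.differentiableAt.differentiableWithinAt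

open Set Metric Topology in
theorem hasDerivAt_mul_radial_integral {g : ℂ × ℂ → ℂ} {V : Set (ℂ × ℂ)} (hV : IsOpen V)
    (hstar : ∀ p ∈ V, ∀ τ ∈ Icc (0 : ℝ) 1, (p.1, (τ : ℂ) * p.2) ∈ V)
    (hg : AnalyticOnNhd ℂ g V) {p : ℂ × ℂ} (hp : p ∈ V) :
    HasDerivAt (fun t : ℂ => t * ∫ τ in (0 : ℝ)..1, g (p.1, (τ : ℂ) * t)) (g p) p.2 := by
  obtain ⟨h1, h2⟩ := hasFDerivAt_radial_integral hV hstar hg hp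
  set D := fun τ : ℝ => fderiv ℂ g (p.1, (τ : ℂ) * p.2) with hD
  have hDc : ContinuousOn (fun τ : ℝ => (D τ).comp
        (radialMap τ))
      (Icc 0 1) := by
    refine ContinuousOn.clm_comp h2 (Continuous.continuousOn ?_)
    unfold radialMap
    fun_prop
  rw [← uIcc_of_le zero_le_one] at hDc h2
  have h3 : HasDerivAt (fun t : ℂ => (p.1, t)) ((0 : ℂ), (1 : ℂ)) p.2 :=
    (hasDerivAt_const p.2 p.1).prodMk (hasDerivAt_id p.2)
  have h4 := (hasDerivAt_id p.2).mul
    (HasFDerivAt.comp_hasDerivAt p.2 (f := fun t : ℂ => (p.1, t)) h1 h3)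
  convert! h4 using 1
  simp only [id, Function.comp, one_mul]
  rw [ContinuousLinearMap.intervalIntegral_apply hDc.intervalIntegrable,
    ← intervalIntegral.integral_const_mul, ← intervalIntegral.integral_add]
  · have h5 : ∀ τ ∈ uIcc (0 : ℝ) 1, HasDerivAt (fun τ : ℝ => (τ : ℂ) * g (p.1, (τ : ℂ) * p.2))
        (g (p.1, (τ : ℂ) * p.2) + p.2 * ((D τ).comp (radialMap τ)) (0, 1)) τ := fun τ hτ => by
      rw [uIcc_of_le zero_le_one] at hτ
      have h6 := (hg _ (hstar p hp τ hτ)).differentiableAt.hasFDerivAt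
      have h7 : HasDerivAt (fun z : ℂ => (p.1, z * p.2)) ((0 : ℂ), 1 * p.2) (τ : ℂ) :=
        (hasDerivAt_const _ p.1).prodMk ((hasDerivAt_id _).mul_const p.2)
      have h8 := ((hasDerivAt_id (τ : ℂ)).mul
        (HasFDerivAt.comp_hasDerivAt (τ : ℂ) (f := fun z : ℂ => (p.1, z * p.2)) h6 h7)).comp_ofReal
      convert! h8 using 1
      simp only [id, Function.comp, one_mul, hD]
      congr 1
      have hL : ∀ (L : ℂ × ℂ →L[ℂ] ℂ) (z : ℂ), L (0, z) = z * L (0, 1) := fun L z => by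
        rw [← smul_eq_mul, ← map_smul]
        simp
      rw [ContinuousLinearMap.comp_apply, radialMap_apply, hL _ p.2, hL _ ((τ : ℂ) * _)]
      ring
    rw [intervalIntegral.integral_eq_sub_of_hasDerivAt h5]
    · simp
    · refine ContinuousOn.intervalIntegrable ?_
      refine ContinuousOn.add ?_ (continuousOn_const.mul (hDc.clm_apply continuousOn_const))
      refine hg.continuousOn.comp (by fun_prop) fun τ hτ => ?_
      rw [uIcc_of_le zero_le_one] at hτ
      exact hstar p hp τ hτ
  · refine ContinuousOn.intervalIntegrable (hg.continuousOn.comp (by fun_prop) fun τ hτ => ?_)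
    rw [uIcc_of_le zero_le_one] at hτ
    exact hstar p hp τ hτ
  · exact (continuousOn_const.mul (hDc.clm_apply continuousOn_const)).intervalIntegrable

theorem star_ball_prod {ρ : ℝ} {p : ℂ × ℂ} (hp : p ∈ Metric.ball (0 : ℂ × ℂ) ρ) {τ : ℝ}
    (hτ : τ ∈ Set.Icc (0 : ℝ) 1) : (p.1, (τ : ℂ) * p.2) ∈ Metric.ball (0 : ℂ × ℂ) ρ := by
  rw [mem_ball_zero_iff, Prod.norm_def, max_lt_iff] at hp ⊢
  refine ⟨hp.1, lt_of_le_of_lt ?_ hp.2⟩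
  simp only [norm_mul, Complex.norm_real, Real.norm_eq_abs, abs_of_nonneg hτ.1]
  exact mul_le_of_le_one_left (norm_nonneg _) hτ.2

/-- The Picard operator of the equation `u' = h (u, Y)` with initial value `c`. -/
noncomputable def picardOp (h Y : ℂ × ℂ → ℂ) (c : ℂ → ℂ) (u : ℂ × ℂ → ℂ) (p : ℂ × ℂ) : ℂ :=
  c p.1 + p.2 * ∫ τ in (0 : ℝ)..1, h (u (p.1, (τ : ℂ) * p.2), Y (p.1, (τ : ℂ) * p.2))

open Set Metric Topology in
theorem exists_analytic_fixedPoint_picardOp {h Y : ℂ × ℂ → ℂ} {c : ℂ → ℂ} {x₁ : ℂ}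
    {r ρ M : ℝ} {K : NNReal} (hr : 0 ≤ r)
    (hh : AnalyticOnNhd ℂ h (closedBall (x₁, 0) r))
    (hK : LipschitzOnWith K h (closedBall (x₁, 0) r))
    (hM : ∀ p ∈ closedBall ((x₁, 0) : ℂ × ℂ) r, ‖h p‖ ≤ M)
    (hY : AnalyticOnNhd ℂ Y (ball 0 ρ)) (hYr : ∀ p ∈ ball (0 : ℂ × ℂ) ρ, ‖Y p‖ ≤ r)
    (hc : AnalyticOnNhd ℂ c (ball 0 ρ)) (hcr : ∀ s ∈ ball (0 : ℂ) ρ, ‖c s - x₁‖ ≤ r / 2)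
    (hρM : ρ * M ≤ r / 2) (hρK : ρ * K ≤ 1 / 2) :
    ∃ u : ℂ × ℂ → ℂ, AnalyticOnNhd ℂ u (ball 0 ρ) ∧
      (∀ p ∈ ball (0 : ℂ × ℂ) ρ, ‖u p - x₁‖ ≤ r) ∧
      ∀ p ∈ ball (0 : ℂ × ℂ) ρ, u p = picardOp h Y c u p := by
  set V := ball (0 : ℂ × ℂ) ρ with hV
  have hVo : IsOpen V := isOpen_ball
  have hp2 : ∀ p ∈ V, ‖p.2‖ ≤ ρ := fun p hp =>
    (norm_snd_le p).trans (mem_ball_zero_iff.1 hp).le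
  have hp1 : ∀ p ∈ V, p.1 ∈ ball (0 : ℂ) ρ := fun p hp =>
    mem_ball_zero_iff.2 ((norm_fst_le p).trans_lt (mem_ball_zero_iff.1 hp))
  let G : (ℂ × ℂ → ℂ) → Prop := fun u => AnalyticOnNhd ℂ u V ∧ ∀ p ∈ V, ‖u p - x₁‖ ≤ r
  have hmem : ∀ u, G u → ∀ p ∈ V, (u p, Y p) ∈ closedBall ((x₁, 0) : ℂ × ℂ) r := by
    intro u hu p hp
    rw [mem_closedBall, dist_eq_norm, Prod.norm_def]
    exact max_le (hu.2 p hp) (by simpa using hYr p hp)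
  have hcomp : ∀ u, G u → AnalyticOnNhd ℂ (fun p => h (u p, Y p)) V := fun u hu p hp =>
    AnalyticAt.fun_comp (f := fun p => (u p, Y p)) (hh _ (hmem u hu p hp))
      ((hu.1 p hp).prod (hY p hp))
  have hstar : ∀ p ∈ V, ∀ τ ∈ Icc (0 : ℝ) 1, (p.1, (τ : ℂ) * p.2) ∈ V :=
    fun p hp τ hτ => star_ball_prod hp hτ
  have hint : ∀ u, G u → ∀ p ∈ V, IntervalIntegrable
      (fun τ : ℝ => h (u (p.1, (τ : ℂ) * p.2), Y (p.1, (τ : ℂ) * p.2)))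
      MeasureTheory.volume 0 1 := by
    intro u hu p hp
    refine ContinuousOn.intervalIntegrable ?_
    rw [uIcc_of_le zero_le_one]
    exact (hcomp u hu).continuousOn.comp
      (f := fun τ : ℝ => ((p.1, (τ : ℂ) * p.2) : ℂ × ℂ)) (by fun_prop)
      fun τ hτ => hstar p hp τ hτ
  have hΦG : ∀ u, G u → G (picardOp h Y c u) := by
    intro u hu
    refine ⟨fun p hp => ?_, fun p hp => ?_⟩
    · exact ((hc _ (hp1 p hp)).fun_comp analyticAt_fst).add
        (analyticAt_snd.mul (analyticOnNhd_radial_integral hVo hstar (hcomp u hu) p hp))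
    · have h1 : ‖∫ τ in (0 : ℝ)..1, h (u (p.1, (τ : ℂ) * p.2), Y (p.1, (τ : ℂ) * p.2))‖ ≤ M := by
        have := intervalIntegral.norm_integral_le_of_norm_le_const (a := (0 : ℝ)) (b := 1) (C := M)
          (f := fun τ : ℝ => h (u (p.1, (τ : ℂ) * p.2), Y (p.1, (τ : ℂ) * p.2)))
          (fun τ hτ => hM _ (hmem u hu _ (hstar p hp τ (by
            rw [uIoc_of_le zero_le_one] at hτ; exact ⟨hτ.1.le, hτ.2⟩))))
        simpa using this
      have h0 : 0 ≤ M := (norm_nonneg _).trans h1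
      calc ‖picardOp h Y c u p - x₁‖
          = ‖(c p.1 - x₁) + p.2 * ∫ τ in (0 : ℝ)..1,
              h (u (p.1, (τ : ℂ) * p.2), Y (p.1, (τ : ℂ) * p.2))‖ := by
            rw [picardOp]; congr 1; ring
        _ ≤ r / 2 + ρ * M := by
            refine (norm_add_le _ _).trans (add_le_add (hcr _ (hp1 p hp)) ?_)
            rw [norm_mul]
            gcongr
            · exact (norm_nonneg _).trans (hp2 p hp)
            · exact hp2 p hp
        _ ≤ r := by linarith
  have hcontr : ∀ u v, G u → G v → ∀ δ : ℝ, (∀ p ∈ V, ‖u p - v p‖ ≤ δ) →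
      ∀ p ∈ V, ‖picardOp h Y c u p - picardOp h Y c v p‖ ≤ δ / 2 := by
    intro u v hu hv δ hδ p hp
    have hδ0 : 0 ≤ δ := (norm_nonneg _).trans (hδ p hp)
    have h1 : ‖∫ τ in (0 : ℝ)..1, (h (u (p.1, (τ : ℂ) * p.2), Y (p.1, (τ : ℂ) * p.2)) -
        h (v (p.1, (τ : ℂ) * p.2), Y (p.1, (τ : ℂ) * p.2)))‖ ≤ K * δ := by
      have := intervalIntegral.norm_integral_le_of_norm_le_const (a := (0 : ℝ)) (b := 1)
        (C := K * δ)
        (f := fun τ : ℝ => h (u (p.1, (τ : ℂ) * p.2), Y (p.1, (τ : ℂ) * p.2)) -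
          h (v (p.1, (τ : ℂ) * p.2), Y (p.1, (τ : ℂ) * p.2))) (fun τ hτ => ?_)
      · simpa using this
      · have hq := hstar p hp τ (by rw [uIoc_of_le zero_le_one] at hτ; exact ⟨hτ.1.le, hτ.2⟩)
        have := hK.dist_le_mul _ (hmem u hu _ hq) _ (hmem v hv _ hq)
        rw [dist_eq_norm] at this
        refine this.trans (mul_le_mul_of_nonneg_left ?_ K.2)
        rw [Prod.dist_eq]
        exact max_le (by simpa [dist_eq_norm] using hδ _ hq) (by simpa using hδ0)
    have h2 : picardOp h Y c u p - picardOp h Y c v p = p.2 * ∫ τ in (0 : ℝ)..1,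
        (h (u (p.1, (τ : ℂ) * p.2), Y (p.1, (τ : ℂ) * p.2)) -
        h (v (p.1, (τ : ℂ) * p.2), Y (p.1, (τ : ℂ) * p.2))) := by
      rw [intervalIntegral.integral_sub (hint u hu p hp) (hint v hv p hp), picardOp, picardOp]
      ring
    rw [h2, norm_mul]
    calc _ ≤ ρ * (K * δ) := by
            gcongr
            · exact (norm_nonneg _).trans (hp2 p hp)
            · exact hp2 p hp
      _ = (ρ * K) * δ := by ring
      _ ≤ 1 / 2 * δ := by gcongr
      _ = δ / 2 := by ring
  let F : ℕ → ℂ × ℂ → ℂ := fun n => (picardOp h Y c)^[n] (fun _ => x₁)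
  have hF1 : ∀ n, F (n + 1) = picardOp h Y c (F n) := fun n => by
    simp only [F]; rw [Function.iterate_succ_apply']
  have hFG : ∀ n, G (F n) := by
    intro n
    induction n with
    | zero => exact ⟨fun p _ => analyticAt_const, fun p _ => by simpa [F] using hr⟩
    | succ n ih => rw [hF1]; exact hΦG _ ih
  have hFd : ∀ n, ∀ p ∈ V, ‖F n p - F (n + 1) p‖ ≤ 2 * r / 2 / 2 ^ n := by
    intro n
    induction n with
    | zero =>
      intro p hp
      have := (hFG 1).2 p hp
      rw [norm_sub_rev]
      simpa [F] using this
    | succ n ih =>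
      intro p hp
      have := hcontr _ _ (hFG n) (hFG (n + 1)) _ ih p hp
      rw [hF1 (n + 1)]
      nth_rewrite 1 [hF1 n]
      refine this.trans (le_of_eq ?_)
      rw [pow_succ]; field_simp
  have hcau : ∀ p ∈ V, ∃ a, Tendsto (fun n => F n p) atTop (𝓝 a) := fun p hp =>
    cauchySeq_tendsto_of_complete (cauchySeq_of_le_geometric_two (C := 2 * r) fun n => by
      rw [dist_eq_norm]; exact hFd n p hp)
  choose! u hu using hcau
  have hub : ∀ n, ∀ p ∈ V, ‖F n p - u p‖ ≤ 2 * r / 2 ^ n := fun n p hp => by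
    have := dist_le_of_le_geometric_two_of_tendsto (C := 2 * r) (f := fun n => F n p)
      (fun n => by rw [dist_eq_norm]; exact hFd n p hp) (hu p hp) n
    rwa [dist_eq_norm] at this
  have hlim : Tendsto (fun n : ℕ => 2 * r / 2 ^ n) atTop (𝓝 0) :=
    tendsto_const_nhds.div_atTop (tendsto_pow_atTop_atTop_of_one_lt one_lt_two)
  have huni : TendstoUniformlyOn F u atTop V := by
    rw [Metric.tendstoUniformlyOn_iff]
    intro ε hε
    filter_upwards [hlim.eventually_lt_const hε] with n hn p hp
    rw [dist_comm, dist_eq_norm]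
    exact (hub n p hp).trans_lt hn
  have hGu : G u := ⟨huni.analyticOnNhd_prod hVo fun n => (hFG n).1, fun p hp =>
    le_of_tendsto (((hu p hp).sub_const x₁).norm) (Eventually.of_forall fun n => (hFG n).2 p hp)⟩
  refine ⟨u, hGu.1, hGu.2, fun p hp => ?_⟩
  refine tendsto_nhds_unique ((hu p hp).comp (tendsto_add_atTop_nat 1)) ?_
  rw [tendsto_iff_dist_tendsto_zero]
  refine squeeze_zero (fun _ => dist_nonneg) (fun n => ?_) (g := fun n : ℕ => 2 * r / 2 ^ n / 2)
    (by simpa using hlim.div_const 2)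
  simp only [Function.comp]
  rw [hF1, dist_eq_norm]
  exact hcontr _ _ (hFG n) hGu _ (hub n) p hp

open Set Metric Topology in
/-- Analytic dependence on a parameter `s` of the solution of `u' = h (u, Y (s, t))`,
`u (s, 0) = c s`. -/
theorem exists_analyticAt_solution {h Y : ℂ × ℂ → ℂ} {c : ℂ → ℂ}
    (hh : AnalyticAt ℂ h (c 0, 0)) (hY : AnalyticAt ℂ Y 0) (hY0 : Y 0 = 0)
    (hc : AnalyticAt ℂ c 0) :
    ∃ u : ℂ × ℂ → ℂ, AnalyticAt ℂ u 0 ∧ (∀ᶠ s in 𝓝 (0 : ℂ), u (s, 0) = c s) ∧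
      ∀ᶠ p in 𝓝 (0 : ℂ × ℂ), HasDerivAt (fun t => u (p.1, t)) (h (u p, Y p)) p.2 := by
  obtain ⟨K, T, hT, hKT⟩ := (hh.contDiffAt (n := 1)).exists_lipschitzOnWith
  have hM := hh.continuousAt.norm.eventually_lt_const (lt_add_one ‖h (c 0, 0)‖)
  set M := ‖h (c 0, 0)‖ + 1
  have hM0 : 0 < M := by positivity
  obtain ⟨r, hr, hrs⟩ := nhds_basis_closedBall.eventually_iff.1
    (hh.eventually_analyticAt.and (hM.and hT))
  have hYe := (hY.continuousAt.norm.eventually_lt_const (u := r) (by simpa [hY0] using hr)).and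
    hY.eventually_analyticAt
  have hce := ((hc.continuousAt.sub_const (c 0)).norm.eventually_lt_const (u := r / 2)
    (by simpa using hr)).and hc.eventually_analyticAt
  obtain ⟨ρ₁, hρ₁, h₁⟩ := nhds_basis_ball.eventually_iff.1 hYe
  obtain ⟨ρ₂, hρ₂, h₂⟩ := nhds_basis_ball.eventually_iff.1 hce
  set ρ := min (min ρ₁ ρ₂) (min (r / 2 / M) (1 / 2 / (K + 1))) with hρ
  have hρ0 : 0 < ρ := by positivity
  have l1 : ρ ≤ ρ₁ := (min_le_left _ _).trans (min_le_left _ _)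
  have l2 : ρ ≤ ρ₂ := (min_le_left _ _).trans (min_le_right _ _)
  have l3 : ρ ≤ r / 2 / M := (min_le_right _ _).trans (min_le_left _ _)
  have l4 : ρ ≤ 1 / 2 / (K + 1) := (min_le_right _ _).trans (min_le_right _ _)
  rw [le_div_iff₀ (by positivity)] at l3 l4
  obtain ⟨u, hu, hur, hfix⟩ := exists_analytic_fixedPoint_picardOp (h := h) (Y := Y) (c := c)
    (x₁ := c 0) (r := r) (ρ := ρ) (M := M) (K := K) hr.le (fun p hp => (hrs hp).1)
    (hKT.mono fun p hp => (hrs hp).2.2) (fun p hp => (hrs hp).2.1.le)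
    (fun p hp => (h₁ (ball_subset_ball l1 hp)).2) (fun p hp => (h₁ (ball_subset_ball l1 hp)).1.le)
    (fun p hp => (h₂ (ball_subset_ball l2 hp)).2) (fun p hp => (h₂ (ball_subset_ball l2 hp)).1.le)
    l3 (by nlinarith [K.2])
  refine ⟨u, hu 0 (mem_ball_self hρ0), ?_, ?_⟩
  · filter_upwards [ball_mem_nhds (0 : ℂ) hρ0] with s hs
    rw [hfix (s, 0) (by simpa [Prod.norm_def, hρ0] using hs)]
    simp [picardOp]
  · filter_upwards [ball_mem_nhds (0 : ℂ × ℂ) hρ0] with p hp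
    have hg : AnalyticOnNhd ℂ (fun p => h (u p, Y p)) (ball 0 ρ) := fun p hp => by
      refine AnalyticAt.fun_comp (f := fun p => (u p, Y p)) (hrs ?_).1
        ((hu p hp).prod (h₁ (ball_subset_ball l1 hp)).2)
      rw [mem_closedBall, dist_eq_norm, Prod.norm_def]
      exact max_le (hur p hp) (by simpa using (h₁ (ball_subset_ball l1 hp)).1.le)
    have := (hasDerivAt_mul_radial_integral isOpen_ball (fun p hp τ hτ => star_ball_prod hp hτ)
      hg hp).const_add (c p.1)
    refine this.congr_of_eventuallyEq ?_
    have : ∀ᶠ t in 𝓝 p.2, (p.1, t) ∈ ball (0 : ℂ × ℂ) ρ :=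
      (isOpen_ball.preimage (f := fun t : ℂ => (p.1, t)) (by fun_prop)).mem_nhds hp
    filter_upwards [this] with t ht
    rw [hfix _ ht, picardOp]

open Set Metric Topology in
theorem eventuallyEq_of_hasDerivAt_eq {h u v : ℂ → ℂ} (hh : AnalyticAt ℂ h (u 0))
    (h0 : u 0 = v 0) (hu : ∀ᶠ t in 𝓝 (0 : ℂ), HasDerivAt u (h (u t)) t)
    (hv : ∀ᶠ t in 𝓝 (0 : ℂ), HasDerivAt v (h (v t)) t) : u =ᶠ[𝓝 0] v := by
  obtain ⟨K, T, hT, hKT⟩ := (hh.contDiffAt (n := 1)).exists_lipschitzOnWith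
  have huT := hu.self_of_nhds.continuousAt.eventually_mem hT
  have hvT := hv.self_of_nhds.continuousAt.eventually_mem (h0 ▸ hT)
  obtain ⟨ρ, hρ, hb⟩ := nhds_basis_ball.eventually_iff.1 ((hu.and huT).and (hv.and hvT))
  filter_upwards [ball_mem_nhds (0 : ℂ) hρ] with t ht
  have hmem : ∀ τ ∈ Icc (0 : ℝ) 1, (τ : ℂ) * t ∈ ball (0 : ℂ) ρ := fun τ hτ => by
    rw [mem_ball_zero_iff] at ht ⊢
    rw [norm_mul, Complex.norm_real, Real.norm_eq_abs, abs_of_nonneg hτ.1]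
    exact (mul_le_of_le_one_left (norm_nonneg _) hτ.2).trans_lt ht
  have hder : ∀ w : ℂ → ℂ, ∀ τ : ℝ, HasDerivAt w (h (w (τ * t))) (τ * t) →
      HasDerivAt (fun τ : ℝ => w (τ * t)) (h (w (τ * t)) * t) τ := fun w τ hw => by
    have h1 : HasDerivAt (fun τ : ℝ => (τ : ℂ) * t) t τ := by
      simpa using (Complex.ofRealCLM.hasDerivAt (x := τ)).mul_const t
    exact HasDerivAt.comp (h₂ := w) (h := fun τ : ℝ => (τ : ℂ) * t) τ hw h1
  have hd : ∀ τ ∈ Icc (0 : ℝ) 1, HasDerivAt (fun τ : ℝ => u (τ * t) - v (τ * t))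
      (h (u (τ * t)) * t - h (v (τ * t)) * t) τ := fun τ hτ =>
    (hder u τ (hb (hmem τ hτ)).1.1).sub (hder v τ (hb (hmem τ hτ)).2.1)
  have := eq_zero_of_abs_deriv_le_mul_abs_self_of_eq_zero_right (K := K * ‖t‖)
    (fun τ hτ => (hd τ hτ).continuousAt.continuousWithinAt)
    (fun τ hτ => (hd τ (Ico_subset_Icc_self hτ)).hasDerivWithinAt) (by simp [h0])
    (fun τ hτ => ?_) 1 (right_mem_Icc.2 zero_le_one)
  · simpa [sub_eq_zero] using this
  · have hm := hb (hmem τ (Ico_subset_Icc_self hτ))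
    have := hKT.dist_le_mul _ hm.1.2 _ hm.2.2
    rw [dist_eq_norm, dist_eq_norm] at this
    rw [← sub_mul, norm_mul, mul_right_comm]
    gcongr

open Set Metric Topology in
theorem exists_transverse_flow {k : ℕ} (hk : 1 ≤ k) :
    ∃ Y : ℂ × ℂ → ℂ, AnalyticAt ℂ Y 0 ∧ (∀ᶠ s in 𝓝 (0 : ℂ), Y (s, 0) = s) ∧
      (∀ t, Y (0, t) = 0) ∧ (∀ᶠ p in 𝓝 (0 : ℂ × ℂ), Y p = 0 → p.1 = 0) ∧
      ∀ᶠ p in 𝓝 (0 : ℂ × ℂ), HasDerivAt (fun t => Y (p.1, t)) (Y p ^ k) p.2 := by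
  obtain ⟨η, hη, hη0, hηd⟩ := exists_analyticAt_solution
    (h := fun q => q.2 ^ (k - 1) * q.1 ^ k) (Y := Prod.fst) (c := fun _ => 1)
    ((analyticAt_snd.pow _).mul (analyticAt_fst.pow _)) analyticAt_fst rfl analyticAt_const
  have h1 : η 0 = 1 := hη0.self_of_nhds
  refine ⟨fun p => p.1 * η p, analyticAt_fst.mul hη, ?_, by simp, ?_, ?_⟩
  · filter_upwards [hη0] with s hs
    simp [hs]
  · filter_upwards [hη.continuousAt.eventually_ne (h1 ▸ one_ne_zero)] with p hp h
    exact (mul_eq_zero.1 h).resolve_right hp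
  · filter_upwards [hηd] with p hp
    convert! hp.const_mul p.1 using 1
    obtain ⟨j, rfl⟩ := Nat.exists_eq_add_of_le' hk
    simp only [add_tsub_cancel_right]
    ring

open Set Metric Topology in
theorem exists_flowBox {k : ℕ} (hk : 1 ≤ k) {f Y : ℂ × ℂ → ℂ} {x₁ : ℂ}
    (hf : AnalyticAt ℂ f (x₁, 0)) (hf0 : f (x₁, 0) ≠ 0) (hY : AnalyticAt ℂ Y 0)
    (hYs : ∀ᶠ s in 𝓝 (0 : ℂ), Y (s, 0) = s)
    (hYt : ∀ᶠ p in 𝓝 (0 : ℂ × ℂ), HasDerivAt (fun t => Y (p.1, t)) (Y p ^ k) p.2) :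
    ∃ e : OpenPartialHomeomorph (ℂ × ℂ) (ℂ × ℂ), 0 ∈ e.source ∧ e 0 = (x₁, 0) ∧
      (∀ᶠ p in 𝓝 0, AnalyticAt ℂ e p ∧ AnalyticAt ℂ e.symm (e p) ∧
        fderiv ℂ e p (0, 1) = (f (e p), (e p).2 ^ k)) ∧ ∀ p, (e p).2 = Y p := by
  have hY0 : Y 0 = 0 := hYs.self_of_nhds
  obtain ⟨u, hu, hu0, hud⟩ := exists_analyticAt_solution (h := f) (Y := Y) (c := fun _ => x₁)
    hf hY hY0 analyticAt_const
  have hu00 : u 0 = x₁ := hu0.self_of_nhds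
  have hFa : AnalyticAt ℂ (fun p => (u p, Y p)) 0 := hu.prod hY
  have hslice : ∀ p : ℂ × ℂ, AnalyticAt ℂ (fun p => (u p, Y p)) p →
      HasDerivAt (fun t => u (p.1, t)) (f (u p, Y p)) p.2 →
      HasDerivAt (fun t => Y (p.1, t)) (Y p ^ k) p.2 →
      fderiv ℂ (fun p => (u p, Y p)) p (0, 1) = (f (u p, Y p), Y p ^ k) := by
    intro p hp h1 h2
    have h3 : HasDerivAt (fun t : ℂ => ((p.1, t) : ℂ × ℂ)) (0, 1) p.2 :=
      (hasDerivAt_const _ _).prodMk (hasDerivAt_id _)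
    exact (HasFDerivAt.comp_hasDerivAt (f := fun t : ℂ => ((p.1, t) : ℂ × ℂ)) p.2
      hp.differentiableAt.hasFDerivAt h3).unique (h1.prodMk h2)
  set L := fderiv ℂ (fun p => (u p, Y p)) 0 with hL
  have hL1 : L (0, 1) = (f (x₁, 0), 0) := by
    rw [hL, hslice 0 hFa hud.self_of_nhds hYt.self_of_nhds, hu00, hY0, zero_pow (by omega)]
  have hL2 : L (1, 0) = (0, 1) := by
    have h3 : HasDerivAt (fun s : ℂ => ((s, 0) : ℂ × ℂ)) (1, 0) 0 :=
      (hasDerivAt_id _).prodMk (hasDerivAt_const _ _)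
    refine (HasFDerivAt.comp_hasDerivAt (f := fun s : ℂ => ((s, 0) : ℂ × ℂ)) (0 : ℂ)
      hFa.differentiableAt.hasFDerivAt h3).unique (HasDerivAt.prodMk ?_ ?_)
    · exact (hasDerivAt_const (0 : ℂ) x₁).congr_of_eventuallyEq hu0
    · exact (hasDerivAt_id (0 : ℂ)).congr_of_eventuallyEq hYs
  have hLv : ∀ v, L v = (v.2 * f (x₁, 0), v.1) := by
    intro v
    have : v = v.1 • ((1, 0) : ℂ × ℂ) + v.2 • ((0, 1) : ℂ × ℂ) := by ext <;> simp
    rw [this, map_add, map_smul, map_smul, hL1, hL2]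
    ext <;> simp
  let Linv : ℂ × ℂ →L[ℂ] ℂ × ℂ := (ContinuousLinearMap.snd ℂ ℂ ℂ).prod
    ((f (x₁, 0))⁻¹ • ContinuousLinearMap.fst ℂ ℂ ℂ)
  let i : (ℂ × ℂ) ≃L[ℂ] ℂ × ℂ := ContinuousLinearEquiv.equivOfInverse L Linv
    (fun v => by ext <;> simp [hLv, Linv]; field_simp)
    (fun v => by ext <;> simp [hLv, Linv]; field_simp)
  have hi : HasStrictFDerivAt (fun p => (u p, Y p)) (i : ℂ × ℂ →L[ℂ] ℂ × ℂ) 0 :=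
    hFa.hasStrictFDerivAt
  let e := hi.toOpenPartialHomeomorph
  have he : ∀ p, e p = (u p, Y p) := fun p => rfl
  have hs0 : (0 : ℂ × ℂ) ∈ e.source := hi.mem_toOpenPartialHomeomorph_source
  have hsymm : AnalyticAt ℂ e.symm (e 0) := e.analyticAt_symm' (i := i) hs0 hFa rfl
  refine ⟨e, hs0, by rw [he, hu00, hY0], ?_, fun p => rfl⟩
  have hcont : ContinuousAt e 0 := hFa.continuousAt
  filter_upwards [hFa.eventually_analyticAt, hcont.eventually hsymm.eventually_analyticAt, hud,
    hYt] with p h1 h2 h3 h4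
  exact ⟨h1, h2, hslice p h1 h3 h4⟩

/-- A pair of charts straightening `f ∂x + y ^ k ∂y` and `f' ∂x + y ^ k ∂y` near `(x₁, 0)`, with the
same second component and which agree on the leaf `y = 0`. -/
structure IsFlowBoxPair (k : ℕ) (f f' : ℂ × ℂ → ℂ) (x₁ : ℂ)
    (e e' : OpenPartialHomeomorph (ℂ × ℂ) (ℂ × ℂ)) : Prop where
  source_eq : e'.source = e.source
  zero_mem : 0 ∈ e.source
  apply_zero : e 0 = (x₁, 0)
  analyticAt : ∀ p ∈ e.source, AnalyticAt ℂ e p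
  analyticAt' : ∀ p ∈ e.source, AnalyticAt ℂ e' p
  analyticAt_symm : ∀ p ∈ e.target, AnalyticAt ℂ e.symm p
  analyticAt_symm' : ∀ p ∈ e'.target, AnalyticAt ℂ e'.symm p
  fderiv_apply : ∀ p ∈ e.source, fderiv ℂ e p (0, 1) = (f (e p), (e p).2 ^ k)
  fderiv_apply' : ∀ p ∈ e.source, fderiv ℂ e' p (0, 1) = (f' (e' p), (e' p).2 ^ k)
  snd_eq : ∀ p ∈ e.source, (e' p).2 = (e p).2
  fst_eq_zero : ∀ p ∈ e.source, (e p).2 = 0 → p.1 = 0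
  leaf_eq : ∀ t : ℂ, (0, t) ∈ e.source → e' (0, t) = e (0, t)

open Set Metric Topology in
theorem exists_isFlowBoxPair {k : ℕ} (hk : 1 ≤ k) {f f' : ℂ × ℂ → ℂ} {x₁ : ℂ}
    (hf : AnalyticAt ℂ f (x₁, 0)) (hf' : AnalyticAt ℂ f' (x₁, 0)) (hf0 : f (x₁, 0) ≠ 0)
    (hf'0 : f' (x₁, 0) ≠ 0) (hagree : ∀ᶠ x in 𝓝 x₁, f (x, 0) = f' (x, 0)) :
    ∃ e e', IsFlowBoxPair k f f' x₁ e e' := by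
  obtain ⟨Y, hY, hYs, hY0, hYz, hYt⟩ := exists_transverse_flow hk
  obtain ⟨e, he0, hex, hea, heY⟩ := exists_flowBox hk hf hf0 hY hYs hYt
  obtain ⟨e', he'0, he'x, he'a, he'Y⟩ := exists_flowBox hk hf' hf'0 hY hYs hYt
  have hd : ∀ (g : ℂ × ℂ → ℂ) (E : ℂ × ℂ → ℂ × ℂ) (t : ℂ), (∀ p, (E p).2 = Y p) →
      AnalyticAt ℂ E (0, t) → fderiv ℂ E (0, t) (0, 1) = (g (E (0, t)), (E (0, t)).2 ^ k) →
      HasDerivAt (fun t => (E (0, t)).1) (g ((E (0, t)).1, 0)) t := by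
    intro g E t hE h1 h2
    have h3 : HasDerivAt (fun t : ℂ => ((0, t) : ℂ × ℂ)) (0, 1) t :=
      (hasDerivAt_const _ _).prodMk (hasDerivAt_id _)
    have h4 := HasFDerivAt.comp_hasDerivAt (f := fun t : ℂ => ((0, t) : ℂ × ℂ)) t
      h1.differentiableAt.hasFDerivAt h3
    rw [h2] at h4
    have h5 : E (0, t) = ((E (0, t)).1, 0) := Prod.ext rfl (by rw [hE, hY0])
    rw [← h5]
    exact (hasFDerivAt_fst.comp_hasDerivAt t h4)
  have hι : Tendsto (fun t : ℂ => ((0, t) : ℂ × ℂ)) (𝓝 0) (𝓝 0) :=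
    Continuous.tendsto' (by fun_prop) _ _ rfl
  have hleaf : ∀ᶠ t in 𝓝 (0 : ℂ), e' (0, t) = e (0, t) := by
    have hc' : Tendsto (fun t : ℂ => (e' (0, t)).1) (𝓝 0) (𝓝 x₁) := by
      have h := (he'a.self_of_nhds.1.continuousAt.tendsto.comp hι).fst_nhds
      rwa [he'x] at h
    have h := eventuallyEq_of_hasDerivAt_eq (h := fun x => f (x, 0))
      (u := fun t => (e (0, t)).1) (v := fun t => (e' (0, t)).1) ?_ ?_ ?_ ?_
    · filter_upwards [h] with t ht
      exact Prod.ext ht.symm (by rw [heY, he'Y])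
    · change AnalyticAt ℂ _ (e 0).1
      rw [hex]
      exact AnalyticAt.fun_comp (f := fun x : ℂ => ((x, 0) : ℂ × ℂ)) hf
        (analyticAt_id.prod analyticAt_const)
    · change (e 0).1 = (e' 0).1
      rw [hex, he'x]
    · filter_upwards [hι.eventually hea] with t ht
      exact hd f e t heY ht.1 ht.2.2
    · filter_upwards [hι.eventually he'a, hc'.eventually hagree] with t ht ht'
      rw [ht']
      exact hd f' e' t he'Y ht.1 ht.2.2
  have hsnd : Tendsto (Prod.snd : ℂ × ℂ → ℂ) (𝓝 0) (𝓝 0) :=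
    Continuous.tendsto' (by fun_prop) _ _ rfl
  set S : Set (ℂ × ℂ) := {p | (AnalyticAt ℂ e p ∧ AnalyticAt ℂ e.symm (e p) ∧
      fderiv ℂ e p (0, 1) = (f (e p), (e p).2 ^ k)) ∧ (AnalyticAt ℂ e' p ∧
      AnalyticAt ℂ e'.symm (e' p) ∧ fderiv ℂ e' p (0, 1) = (f' (e' p), (e' p).2 ^ k)) ∧
      (Y p = 0 → p.1 = 0) ∧ e' (0, p.2) = e (0, p.2)} with hS
  have hSn : S ∈ 𝓝 0 := hea.and (he'a.and (hYz.and (hsnd.eventually hleaf)))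
  have hsrc : (e.restr (S ∩ e'.source)).source = e.source ∩ (interior S ∩ e'.source) := by
    rw [OpenPartialHomeomorph.restr_source, interior_inter, e'.open_source.interior_eq]
  have hsrc' : (e'.restr (S ∩ e.source)).source = e'.source ∩ (interior S ∩ e.source) := by
    rw [OpenPartialHomeomorph.restr_source, interior_inter, e.open_source.interior_eq]
  have hSm : ∀ p ∈ (e.restr (S ∩ e'.source)).source, p ∈ S := fun p hp => by
    rw [hsrc] at hp; exact interior_subset hp.2.1
  refine ⟨e.restr (S ∩ e'.source), e'.restr (S ∩ e.source), ?_, ?_, hex,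
    fun p hp => (hSm p hp).1.1, fun p hp => (hSm p hp).2.1.1, fun p hp => ?_, fun p hp => ?_,
    fun p hp => (hSm p hp).1.2.2, fun p hp => (hSm p hp).2.1.2.2,
    fun p _ => (he'Y p).trans (heY p).symm, fun p hp h => (hSm p hp).2.2.1 ((heY p).symm.trans h),
    fun t ht => (hSm _ ht).2.2.2⟩
  · rw [hsrc, hsrc']; ext p; simp only [mem_inter_iff]; tauto
  · rw [hsrc]; exact ⟨he0, mem_interior_iff_mem_nhds.2 hSn, he'0⟩
  · have h1 := hSm _ ((e.restr (S ∩ e'.source)).map_target hp)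
    have h2 := h1.1.2.1
    rwa [show e ((e.restr (S ∩ e'.source)).symm p) = p from
      (e.restr (S ∩ e'.source)).right_inv hp] at h2
  · have h0 := (e'.restr (S ∩ e.source)).map_target hp
    rw [hsrc'] at h0
    have h2 := (interior_subset h0.2.1 : _ ∈ S).2.1.2.1
    rwa [show e' ((e'.restr (S ∩ e.source)).symm p) = p from
      (e'.restr (S ∩ e.source)).right_inv hp] at h2

open Set Metric Topology in
theorem eventuallyEq_of_isPreconnected_of_analyticAt {P Q : ℂ × ℂ → ℂ}
    {S : Set (ℂ × ℂ)} (hS : IsPreconnected S)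
    (hP : ∀ x ∈ S, AnalyticAt ℂ P x) (hQ : ∀ x ∈ S, AnalyticAt ℂ Q x) {x₀ : ℂ × ℂ}
    (hx₀ : x₀ ∈ S) (h : P =ᶠ[𝓝 x₀] Q) {x : ℂ × ℂ} (hx : x ∈ S) : P =ᶠ[𝓝 x] Q := by
  have hUo : IsOpen {x | AnalyticAt ℂ P x ∧ AnalyticAt ℂ Q x} :=
    (isOpen_analyticAt ℂ P).inter (isOpen_analyticAt ℂ Q)
  have hsub := hS.subset_connectedComponentIn hx₀
    (F := {x | AnalyticAt ℂ P x ∧ AnalyticAt ℂ Q x}) fun x hx => ⟨hP x hx, hQ x hx⟩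
  have hCU := connectedComponentIn_subset {x | AnalyticAt ℂ P x ∧ AnalyticAt ℂ Q x} x₀
  have heq := AnalyticOnNhd.eqOn_of_preconnected_of_eventuallyEq (𝕜 := ℂ) (f := P) (g := Q)
    (fun y hy => (hCU hy).1) (fun y hy => (hCU hy).2) isPreconnected_connectedComponentIn
    (hsub hx₀) h
  exact heq.eventuallyEq_of_mem (hUo.connectedComponentIn.mem_nhds (hsub hx))

/-- `(x, y) ↦ (g (x, y), y)` conjugates `f ∂x + y ^ k ∂y` to `f' ∂x + y ^ k ∂y` near `(x, 0)` and is
the identity on the leaf `y = 0`. -/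
def IsConjAt (k : ℕ) (f f' g : ℂ × ℂ → ℂ) (x : ℂ) : Prop :=
  AnalyticAt ℂ g (x, 0) ∧ ∀ᶠ p in nhds ((x, 0) : ℂ × ℂ),
    fderiv ℂ g p (f p, p.2 ^ k) = f' (g p, p.2) ∧ (p.2 = 0 → g p = p.1)

namespace IsConjAt

variable {k : ℕ} {f f' g g' : ℂ × ℂ → ℂ} {x : ℂ}

theorem apply_eq (h : IsConjAt k f f' g x) : g (x, 0) = x := h.2.self_of_nhds.2 rfl

open Topology in
theorem congr (h : IsConjAt k f f' g x) (hg : g =ᶠ[𝓝 (x, 0)] g') : IsConjAt k f f' g' x := by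
  refine ⟨h.1.congr hg, ?_⟩
  filter_upwards [h.2, hg, hg.fderiv (𝕜 := ℂ)] with p hp h1 h2
  rw [← h1, ← h2]
  exact hp

end IsConjAt

open Set Metric Topology in
theorem exists_eventuallyEq_translation {A : ℂ × ℂ → ℂ × ℂ} {t₂ : ℂ}
    (hA : AnalyticAt ℂ A (0, t₂)) (hA0 : A (0, t₂) = (0, t₂))
    (hd : ∀ᶠ p in 𝓝 ((0, t₂) : ℂ × ℂ), fderiv ℂ A p (0, 1) = (0, 1)) :
    ∃ a b : ℂ → ℂ, AnalyticAt ℂ a 0 ∧ AnalyticAt ℂ b 0 ∧ a 0 = 0 ∧ b 0 = 0 ∧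
      ∀ᶠ p in 𝓝 ((0, t₂) : ℂ × ℂ), A p = (b p.1, p.2 + a p.1) := by
  have hι : AnalyticAt ℂ (fun s : ℂ => A (s, t₂)) 0 :=
    AnalyticAt.fun_comp (f := fun s : ℂ => ((s, t₂) : ℂ × ℂ)) hA
      (analyticAt_id.prod analyticAt_const)
  refine ⟨fun s => (A (s, t₂)).2 - t₂, fun s => (A (s, t₂)).1,
    (analyticAt_snd.fun_comp hι).sub analyticAt_const, analyticAt_fst.fun_comp hι,
    by simp [hA0], by simp [hA0], ?_⟩
  obtain ⟨ρ, hρ, hb⟩ := nhds_basis_ball.eventually_iff.1 (hA.eventually_analyticAt.and hd)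
  filter_upwards [ball_mem_nhds _ hρ] with p hp
  rw [← ball_prod_same] at hp
  have hder : ∀ t ∈ ball t₂ ρ, HasDerivAt (fun t => A (p.1, t) - (0, t)) 0 t := by
    intro t ht
    have hm := @hb (p.1, t) (by rw [← ball_prod_same]; exact ⟨hp.1, ht⟩)
    have h3 : HasDerivAt (fun t : ℂ => ((p.1, t) : ℂ × ℂ)) (0, 1) t :=
      (hasDerivAt_const _ _).prodMk (hasDerivAt_id _)
    have h4 := HasFDerivAt.comp_hasDerivAt (f := fun t : ℂ => ((p.1, t) : ℂ × ℂ)) t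
      hm.1.differentiableAt.hasFDerivAt h3
    rw [hm.2] at h4
    have h5 : HasDerivAt (fun t : ℂ => ((0, t) : ℂ × ℂ)) (0, 1) t :=
      (hasDerivAt_const _ _).prodMk (hasDerivAt_id _)
    have h6 := h4.sub h5
    rw [sub_self] at h6
    exact h6
  have := isOpen_ball.is_const_of_deriv_eq_zero (convex_ball t₂ ρ).isPreconnected
    (fun t ht => (hder t ht).differentiableAt.differentiableWithinAt)
    (fun t ht => (hder t ht).deriv) hp.2 (mem_ball_self hρ)
  simp only [Prod.mk.eta] at this
  rw [sub_eq_iff_eq_add.1 this]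
  ext <;> simp
  ring

namespace IsFlowBoxPair

variable {k : ℕ} {f f' : ℂ × ℂ → ℂ} {x₁ : ℂ} {e e' : OpenPartialHomeomorph (ℂ × ℂ) (ℂ × ℂ)}

open Set Metric Topology in
theorem exists_ball (h : IsFlowBoxPair k f f' x₁ e e') : ∀ᶠ x in 𝓝 x₁,
    ∃ t : ℂ, (0, t) ∈ e.source ∧ e (0, t) = (x, 0) := by
  have hι : Tendsto (fun x : ℂ => ((x, 0) : ℂ × ℂ)) (𝓝 x₁) (𝓝 (x₁, 0)) :=
    Continuous.tendsto (by fun_prop) _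
  have ht : (x₁, 0) ∈ e.target := h.apply_zero ▸ e.map_source h.zero_mem
  filter_upwards [hι.eventually (e.open_target.mem_nhds ht)] with x hx
  have h1 := e.map_target hx
  have h2 : (e.symm (x, 0)).1 = 0 := h.fst_eq_zero _ h1 (by rw [e.right_inv hx])
  have h3 : (0, (e.symm (x, 0)).2) = e.symm (x, 0) := Prod.ext h2.symm rfl
  exact ⟨(e.symm (x, 0)).2, h3 ▸ h1, h3 ▸ e.right_inv hx⟩

/-- The first component of the map which is `A` in the coordinates `e`, `e'`. -/
noncomputable def conj (e e' : OpenPartialHomeomorph (ℂ × ℂ) (ℂ × ℂ)) (A : ℂ × ℂ → ℂ × ℂ)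
    (p : ℂ × ℂ) : ℂ := (e' (A (e.symm p))).1

open Set Metric Topology in
theorem analyticAt_conj (h : IsFlowBoxPair k f f' x₁ e e') {A : ℂ × ℂ → ℂ × ℂ} {t : ℂ}
    (ht : (0, t) ∈ e.source) (hA : AnalyticAt ℂ A (0, t)) (hA0 : A (0, t) = (0, t)) :
    AnalyticAt ℂ (conj e e' A) (e (0, t)) ∧ conj e e' A (e (0, t)) = (e (0, t)).1 := by
  have hs : e.symm (e (0, t)) = (0, t) := e.left_inv ht
  refine ⟨analyticAt_fst.fun_comp ?_, ?_⟩
  · refine AnalyticAt.fun_comp (g := e') (f := fun p => A (e.symm p)) ?_ ?_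
    · rw [hs, hA0]; exact h.analyticAt' _ ht
    · refine AnalyticAt.fun_comp (g := A) (f := e.symm) (by rwa [hs])
        (h.analyticAt_symm _ (e.map_source ht))
  · rw [conj, hs, hA0, h.leaf_eq t ht]

open Set Metric Topology in
theorem isConjAt_conj_id (h : IsFlowBoxPair k f f' x₁ e e') :
    IsConjAt k f f' (conj e e' id) x₁ := by
  have h0 : e (0, 0) = (x₁, 0) := h.apply_zero
  have ht : (x₁, 0) ∈ e.target := h0 ▸ e.map_source h.zero_mem
  refine ⟨h0 ▸ (h.analyticAt_conj h.zero_mem analyticAt_id rfl).1, ?_⟩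
  filter_upwards [e.open_target.mem_nhds ht] with p hp
  have hq := e.map_target hp
  obtain ⟨q, hqs, rfl⟩ : ∃ q ∈ e.source, e q = p := ⟨_, hq, e.right_inv hp⟩
  have hsymm : e.symm (e q) = q := e.left_inv hqs
  constructor
  · rw [← h.fderiv_apply q hqs]
    have h1 : HasFDerivAt (fun p => (conj e e' id (e p))) (fderiv ℂ (conj e e' id) (e q) ∘L
        fderiv ℂ e q) q := by
      refine HasFDerivAt.comp (g := conj e e' id) q (DifferentiableAt.hasFDerivAt ?_)
        (h.analyticAt q hqs).differentiableAt.hasFDerivAt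
      refine (analyticAt_fst.fun_comp (AnalyticAt.fun_comp (g := e') (f := e.symm) ?_
        (h.analyticAt_symm _ hp))).differentiableAt
      rw [hsymm]; exact h.analyticAt' q hqs
    have h2 : HasFDerivAt (fun p => (e' p).1) ((ContinuousLinearMap.fst ℂ ℂ ℂ) ∘L
        fderiv ℂ e' q) q :=
      hasFDerivAt_fst.comp q (h.analyticAt' q hqs).differentiableAt.hasFDerivAt
    have h3 := h1.unique (h2.congr_of_eventuallyEq (by
      filter_upwards [e.open_source.mem_nhds hqs] with p hp
      simp [conj, e.left_inv hp]))
    have h4 := DFunLike.congr_fun h3 (0, 1)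
    simp only [ContinuousLinearMap.comp_apply] at h4
    rw [h4, h.fderiv_apply' q hqs]
    simp only [conj, hsymm, id, ← h.snd_eq q hqs]
    rfl
  · intro hp2
    have h5 : q = (0, q.2) := Prod.ext (h.fst_eq_zero q hqs hp2) rfl
    rw [h5] at hqs ⊢
    exact (h.analyticAt_conj hqs analyticAt_id rfl).2

open Set Metric Topology in
theorem exists_translation (h : IsFlowBoxPair k f f' x₁ e e') {t₂ x₂ : ℂ} (ht : (0, t₂) ∈ e.source)
    (hx₂ : e (0, t₂) = (x₂, 0)) {g : ℂ × ℂ → ℂ} (hg : IsConjAt k f f' g x₂) :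
    ∃ a b : ℂ → ℂ, AnalyticAt ℂ a 0 ∧ AnalyticAt ℂ b 0 ∧ a 0 = 0 ∧ b 0 = 0 ∧
      conj e e' (fun p => (b p.1, p.2 + a p.1)) =ᶠ[𝓝 (x₂, 0)] g := by
  have ht' : (0, t₂) ∈ e'.source := h.source_eq ▸ ht
  have hx₂' : e' (0, t₂) = (x₂, 0) := (h.leaf_eq _ ht).trans hx₂
  have hxt' : (x₂, 0) ∈ e'.target := hx₂' ▸ e'.map_source ht'
  have hxt : (x₂, 0) ∈ e.target := hx₂ ▸ e.map_source ht
  set Φ : ℂ × ℂ → ℂ × ℂ := fun p => (g p, p.2) with hΦ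
  have hΦa : AnalyticAt ℂ Φ (x₂, 0) := hg.1.prod analyticAt_snd
  have hΦ0 : Φ (x₂, 0) = (x₂, 0) := Prod.ext hg.apply_eq rfl
  have hea := h.analyticAt _ ht
  have hΦe : AnalyticAt ℂ (fun p => Φ (e p)) (0, t₂) :=
    AnalyticAt.fun_comp (g := Φ) (f := e) (by rwa [hx₂]) hea
  have hΦe0 : Φ (e (0, t₂)) = (x₂, 0) := by rw [hx₂, hΦ0]
  have hAa : AnalyticAt ℂ (fun p => e'.symm (Φ (e p))) (0, t₂) :=
    AnalyticAt.fun_comp (g := e'.symm) (f := fun p => Φ (e p))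
      (by rw [hΦe0]; exact h.analyticAt_symm' _ hxt') hΦe
  have hA0 : e'.symm (Φ (e (0, t₂))) = (0, t₂) := by rw [hΦe0, ← hx₂', e'.left_inv ht']
  have hec : Tendsto e (𝓝 (0, t₂)) (𝓝 (x₂, 0)) := hx₂ ▸ hea.continuousAt.tendsto
  have hΦc : Tendsto (fun p => Φ (e p)) (𝓝 (0, t₂)) (𝓝 (x₂, 0)) := by
    have := hΦe.continuousAt.tendsto; rwa [hΦe0] at this
  obtain ⟨a, b, ha, hb, ha0, hb0, hab⟩ := exists_eventuallyEq_translation hAa hA0 (by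
    filter_upwards [e.open_source.mem_nhds ht, hec.eventually hΦa.eventually_analyticAt,
      hΦc.eventually (e'.open_target.mem_nhds hxt'), hec.eventually hg.2,
      hec.eventually hg.1.eventually_analyticAt] with p hp hp1 hp2 hp3 hp4
    have hq := e'.map_target hp2
    set q := e'.symm (Φ (e p)) with hqd
    have hqs : q ∈ e.source := h.source_eq ▸ hq
    have heq : e' q = Φ (e p) := e'.right_inv hp2
    have d1 : HasFDerivAt (fun p => Φ (e p)) ((fderiv ℂ Φ (e p)).comp (fderiv ℂ e p)) p :=
      HasFDerivAt.comp (g := Φ) p hp1.differentiableAt.hasFDerivAt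
        (h.analyticAt p hp).differentiableAt.hasFDerivAt
    have d2 : HasFDerivAt (fun p => e'.symm (Φ (e p))) ((fderiv ℂ e'.symm (Φ (e p))).comp
        ((fderiv ℂ Φ (e p)).comp (fderiv ℂ e p))) p :=
      HasFDerivAt.comp (g := e'.symm) p
        (h.analyticAt_symm' _ hp2).differentiableAt.hasFDerivAt d1
    have d3 : HasFDerivAt (fun p => e'.symm (e' p)) ((fderiv ℂ e'.symm (e' q)).comp
        (fderiv ℂ e' q)) q :=
      HasFDerivAt.comp (g := e'.symm) q
        (h.analyticAt_symm' _ (heq ▸ hp2)).differentiableAt.hasFDerivAt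
        (h.analyticAt' q hqs).differentiableAt.hasFDerivAt
    have d4 := d3.unique ((hasFDerivAt_id q).congr_of_eventuallyEq (by
      filter_upwards [e'.open_source.mem_nhds hq] with p hp
      exact e'.left_inv hp))
    have d5 : HasFDerivAt Φ ((fderiv ℂ g (e p)).prod (ContinuousLinearMap.snd ℂ ℂ ℂ)) (e p) :=
      hp4.differentiableAt.hasFDerivAt.prodMk hasFDerivAt_snd
    rw [d2.fderiv]
    simp only [ContinuousLinearMap.comp_apply]
    rw [h.fderiv_apply p hp, d5.fderiv]
    simp only [ContinuousLinearMap.prod_apply, ContinuousLinearMap.coe_snd']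
    rw [hp3.1]
    have d6 := h.fderiv_apply' q hqs
    rw [heq] at d6
    change _ = (f' (g (e p), (e p).2), (e p).2 ^ k) at d6
    rw [← d6, ← heq]
    exact DFunLike.congr_fun d4 (0, 1))
  refine ⟨a, b, ha, hb, ha0, hb0, ?_⟩
  have hsc : Tendsto e.symm (𝓝 (x₂, 0)) (𝓝 (0, t₂)) := by
    have := (h.analyticAt_symm _ hxt).continuousAt.tendsto
    rwa [← hx₂, e.left_inv ht, hx₂] at this
  have hΦc2 : Tendsto Φ (𝓝 (x₂, 0)) (𝓝 (x₂, 0)) := by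
    have := hΦa.continuousAt.tendsto; rwa [hΦ0] at this
  filter_upwards [e.open_target.mem_nhds hxt, hsc.eventually hab,
    hΦc2.eventually (e'.open_target.mem_nhds hxt')] with p hp hp1 hp2
  rw [conj, ← hp1, e.right_inv hp, e'.right_inv hp2]

end IsFlowBoxPair

open Set Metric Topology in
/-- Near every point of the leaf, germs of conjugacies extend along the leaf. -/
theorem exists_ball_isConjAt_extension {k : ℕ} (hk : 1 ≤ k) {Ω : Set ℂ} (hΩ : IsOpen Ω)
    {f f' : ℂ × ℂ → ℂ} (hf : ∀ x ∈ Ω, AnalyticAt ℂ f (x, 0))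
    (hf' : ∀ x ∈ Ω, AnalyticAt ℂ f' (x, 0)) (hfz : ∀ x ∈ Ω, f (x, 0) ≠ 0)
    (hfz' : ∀ x ∈ Ω, f' (x, 0) ≠ 0) (hagree : ∀ x ∈ Ω, f (x, 0) = f' (x, 0)) {x₁ : ℂ}
    (hx₁ : x₁ ∈ Ω) : (∃ g, IsConjAt k f f' g x₁) ∧ ∃ r > 0, ball x₁ r ⊆ Ω ∧
      ∀ x₂ ∈ ball x₁ r, ∀ g, IsConjAt k f f' g x₂ →
        ∃ g', g' =ᶠ[𝓝 (x₂, 0)] g ∧ ∀ x ∈ ball x₁ r, IsConjAt k f f' g' x := by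
  obtain ⟨e, e', h⟩ := exists_isFlowBoxPair hk (hf _ hx₁) (hf' _ hx₁) (hfz _ hx₁) (hfz' _ hx₁)
    (eventually_of_mem (hΩ.mem_nhds hx₁) hagree)
  refine ⟨⟨_, h.isConjAt_conj_id⟩, ?_⟩
  obtain ⟨r, hr, hb⟩ := nhds_basis_ball.eventually_iff.1 (h.exists_ball.and (hΩ.mem_nhds hx₁))
  refine ⟨r, hr, fun x hx => (hb hx).2, fun x₂ hx₂ g hg => ?_⟩
  obtain ⟨t₂, ht₂, hex₂⟩ := (hb hx₂).1
  obtain ⟨a, b, ha, hb', ha0, hb0, hab⟩ := h.exists_translation ht₂ hex₂ hg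
  set G := IsFlowBoxPair.conj e e' fun p => (b p.1, p.2 + a p.1) with hG
  refine ⟨G, hab, ?_⟩
  have hG' : ∀ x ∈ ball x₁ r, AnalyticAt ℂ G (x, 0) ∧ G (x, 0) = x := by
    intro x hx
    obtain ⟨t, ht, hex⟩ := (hb hx).1
    have := h.analyticAt_conj (A := fun p => (b p.1, p.2 + a p.1)) ht
      ((AnalyticAt.fun_comp (g := b) (f := Prod.fst) hb' analyticAt_fst).prod
        (analyticAt_snd.add (AnalyticAt.fun_comp (g := a) (f := Prod.fst) ha analyticAt_fst)))
      (by simp [ha0, hb0])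
    rwa [hex] at this
  have hconj := hg.congr hab.symm
  have hpre : IsPreconnected (ball x₁ r ×ˢ ({0} : Set ℂ)) :=
    (convex_ball x₁ r).isPreconnected.prod isPreconnected_singleton
  have hmem : ∀ p ∈ ball x₁ r ×ˢ ({0} : Set ℂ), p = (p.1, 0) := fun p hp => Prod.ext rfl hp.2
  have hGa : ∀ p ∈ ball x₁ r ×ˢ ({0} : Set ℂ), AnalyticAt ℂ G p := fun p hp => by
    rw [hmem p hp]; exact (hG' p.1 hp.1).1
  intro x hx
  have heq := eventuallyEq_of_isPreconnected_of_analyticAt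
    (P := fun p => fderiv ℂ G p (f p, p.2 ^ k)) (Q := fun p => f' (G p, p.2)) hpre
    (fun p hp => by
      refine AnalyticAt.fun_comp (f := fun p : ℂ × ℂ => (fderiv ℂ G p, (f p, p.2 ^ k)))
        ((ContinuousLinearMap.id ℂ (ℂ × ℂ →L[ℂ] ℂ)).analyticAt_bilinear _)
        ((hGa p hp).fderiv.prod (AnalyticAt.prod ?_ (analyticAt_snd.pow _)))
      rw [hmem p hp]
      exact hf p.1 (hb hp.1).2)
    (fun p hp => by
      refine AnalyticAt.fun_comp (g := f') (f := fun p => (G p, p.2)) ?_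
        ((hGa p hp).prod analyticAt_snd)
      have h1 := hG' p.1 hp.1
      rw [← hmem p hp] at h1
      rw [h1.2, show p.2 = 0 from hp.2]
      exact hf' p.1 (hb hp.1).2)
    (x₀ := (x₂, 0)) ⟨hx₂, rfl⟩ (hconj.2.mono fun p hp => hp.1) (x := (x, 0)) ⟨hx, rfl⟩
  refine ⟨(hG' x hx).1, ?_⟩
  have hfst : Tendsto (Prod.fst : ℂ × ℂ → ℂ) (𝓝 (x, 0)) (𝓝 x) := continuous_fst.tendsto _
  filter_upwards [heq, hfst.eventually (isOpen_ball.mem_nhds hx)] with p hp hp1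
  refine ⟨hp, fun hp2 => ?_⟩
  have := (hG' p.1 hp1).2
  rwa [← hp2] at this

open Set Topology in
/-- A locally constant family of sets over a simply connected space, given by its stalks `S x` and
transport bijections `T i x` for `x` in a neighborhood `B i` of `i`, has a global section through
every element of a stalk. -/
theorem exists_section_of_locallyConstant {X : Type*} [TopologicalSpace X] [SimplyConnectedSpace X]
    [LocallyPathConnectedSpace X] {S : X → Type*} (T : ∀ i x, S i ≃ S x)
    (hTself : ∀ i q, T i i q = q) (B : X → Set X) (hBo : ∀ i, IsOpen (B i)) (hB : ∀ i, i ∈ B i)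
    (hT : ∀ i j, ∀ x ∈ B i ∩ B j, ∀ q q', T i x q = T j x q' → ∀ᶠ x' in 𝓝 x, T i x' q = T j x' q')
    (x₀ : X) (q₀ : S x₀) :
    ∃ q : ∀ x, S x, ∀ i, ∀ᶠ x in 𝓝 i, q x = T i x (q i) := by
  let F := S x₀
  let _ : TopologicalSpace F := ⊥
  have _ : DiscreteTopology F := ⟨rfl⟩
  let φ : ∀ i, S i ≃ F := fun i => T i x₀
  let Z : FiberBundleCore X X F :=
    { baseSet := B
      isOpen_baseSet := hBo
      indexAt := id
      mem_baseSet_at := hB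
      coordChange := fun i j x v => φ j ((T j x).symm (T i x ((φ i).symm v)))
      coordChange_self := fun i x _ v => by simp
      continuousOn_coordChange := fun i j => by
        rintro ⟨x, v⟩ ⟨hx, -⟩
        refine ContinuousAt.continuousWithinAt ?_
        refine tendsto_nhds_of_eventually_eq ?_
        rw [nhds_prod_eq, nhds_discrete F, prod_pure, eventually_map]
        filter_upwards [hT i j x hx ((φ i).symm v) ((T j x).symm (T i x ((φ i).symm v)))
          (by simp)] with x' hx'
        change φ j ((T j x').symm (T i x' _)) = φ j ((T j x).symm (T i x _))
        rw [hx', Equiv.symm_apply_apply]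
      coordChange_comp := fun i j k x _ v => by simp }
  have hcov : IsCoveringMap (Bundle.TotalSpace.proj : Bundle.TotalSpace F Z.Fiber → X) :=
    FiberBundle.isCoveringMap
  obtain ⟨s, ⟨-, hs⟩, -⟩ := hcov.existsUnique_continuousMap_lifts (ContinuousMap.id X) x₀
    (⟨x₀, q₀⟩ : Bundle.TotalSpace F Z.Fiber) rfl
  have hs' : ∀ x, (s x).proj = x := fun x => congrFun hs x
  refine ⟨fun x => (φ x).symm (show F from (s x).snd), fun i => ?_⟩
  have hsrc : s i ∈ (Z.localTriv i).source := by
    rw [Z.mem_localTriv_source, hs']; exact hB i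
  have hcont : ContinuousAt (fun x => (Z.localTriv i (s x)).2) i :=
    continuousAt_snd.comp (((Z.localTriv i).continuousAt hsrc).comp s.continuous.continuousAt)
  have hev := hcont.eventually_mem (mem_nhds_discrete.2 (mem_singleton _))
  filter_upwards [hev] with x hx
  simp only [mem_singleton_iff, FiberBundleCore.localTriv_apply, hs'] at hx
  have h1 : φ i ((T i x).symm (T x x ((φ x).symm (s x).snd))) =
    φ i ((T i i).symm (T i i ((φ i).symm (s i).snd))) := hx
  rw [Equiv.symm_apply_apply, EmbeddingLike.apply_eq_iff_eq, hTself, Equiv.symm_apply_eq] at h1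
  exact h1

open Set Topology in
/-- Gluing of locally extendable germs over a simply connected space: `P x a` says that `a` has a
good germ at `x` and `R x a b` that `a` and `b` have the same germ at `x`. -/
theorem exists_compatible_choice {X A : Type*} [TopologicalSpace X] [SimplyConnectedSpace X]
    [LocallyPathConnectedSpace X] (R : X → Setoid A) (P : X → A → Prop)
    (hR : ∀ x a b, R x a b → ∀ᶠ x' in 𝓝 x, R x' a b)
    (hne : ∀ x, ∃ a, P x a)
    (hloc : ∀ x, ∃ B : Set X, IsOpen B ∧ x ∈ B ∧
      (∀ x₂ ∈ B, ∀ a, P x₂ a → ∃ a', R x₂ a' a ∧ ∀ y ∈ B, P y a') ∧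
      ∀ a a', (∀ y ∈ B, P y a) → (∀ y ∈ B, P y a') → ∀ y ∈ B, R y a a' → ∀ z ∈ B, R z a a') :
    ∃ σ : X → A, ∀ x, P x (σ x) ∧ ∀ᶠ x' in 𝓝 x, R x' (σ x) (σ x') := by
  classical
  choose B hBo hB hext hid using hloc
  let S : X → Type _ := fun x => Quotient ((R x).comap (Subtype.val : {a // P x a} → A))
  have hex : ∀ x (a b : {a // P x a}), (Quotient.mk _ a : S x) = Quotient.mk _ b → R x a b :=
    fun x a b h => Quotient.exact (s := (R x).comap Subtype.val) h
  have hrep : ∀ i (q : S i), ∃ a, ∃ h : ∀ y ∈ B i, P y a,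
      (Quotient.mk _ ⟨a, h i (hB i)⟩ : S i) = q := by
    intro i q
    obtain ⟨⟨b, hb⟩, rfl⟩ := Quotient.exists_rep q
    obtain ⟨a, hab, ha⟩ := hext i i (hB i) b hb
    exact ⟨a, ha, Quotient.sound hab⟩
  choose rep hP hmk using hrep
  let t : ∀ i x, x ∈ B i → S i → S x := fun i x hx q => Quotient.mk _ ⟨rep i q, hP i q x hx⟩
  have ht : ∀ i x (hx : x ∈ B i), Function.Bijective (t i x hx) := by
    intro i x hx
    constructor
    · intro q q' h
      have h1 : R x (rep i q) (rep i q') := hex _ _ _ h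
      rw [← hmk i q, ← hmk i q']
      exact Quotient.sound (hid i _ _ (hP i q) (hP i q') x hx h1 i (hB i))
    · intro q
      obtain ⟨⟨b, hb⟩, rfl⟩ := Quotient.exists_rep q
      obtain ⟨a, hab, ha⟩ := hext i x hx b hb
      refine ⟨Quotient.mk _ ⟨a, ha i (hB i)⟩, Quotient.sound ?_⟩
      have h1 : R i (rep i (Quotient.mk _ ⟨a, ha i (hB i)⟩)) a := hex _ _ _ (hmk i _)
      exact (R x).trans (hid i _ _ (hP i _) ha i (hB i) h1 x hx) hab
  have heqv : ∀ x y, Nonempty (S x ≃ S y) := by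
    refine PreconnectedSpace.induction₂' _ (fun x => ?_) ⟨fun _ _ _ ⟨a⟩ ⟨b⟩ => ⟨a.trans b⟩⟩
    filter_upwards [(hBo x).mem_nhds (hB x)] with y hy
    exact ⟨⟨Equiv.ofBijective _ (ht x y hy)⟩, ⟨(Equiv.ofBijective _ (ht x y hy)).symm⟩⟩
  let T : ∀ i x, S i ≃ S x := fun i x =>
    if hx : x ∈ B i then Equiv.ofBijective _ (ht i x hx) else (heqv i x).some
  have hTt : ∀ i x (hx : x ∈ B i) q, T i x q = Quotient.mk _ ⟨rep i q, hP i q x hx⟩ := by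
    intro i x hx q
    simp only [T, dif_pos hx]
    rfl
  obtain ⟨x₀⟩ : Nonempty X := inferInstance
  obtain ⟨a₀, ha₀⟩ := hne x₀
  obtain ⟨q, hq⟩ := exists_section_of_locallyConstant T
    (fun i q => (hTt i i (hB i) q).trans (hmk i q)) B hBo hB (fun i j x hx q q' h => by
      rw [hTt i x hx.1, hTt j x hx.2] at h
      filter_upwards [hR x _ _ (hex _ _ _ h), (hBo i).mem_nhds hx.1,
        (hBo j).mem_nhds hx.2] with x' h1 h2 h3
      rw [hTt i x' h2, hTt j x' h3]
      exact Quotient.sound h1) x₀ (Quotient.mk _ ⟨a₀, ha₀⟩)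
  refine ⟨fun x => rep x (q x), fun x => ⟨hP x _ x (hB x), ?_⟩⟩
  filter_upwards [hq x, (hBo x).mem_nhds (hB x)] with x' h1 h2
  rw [hTt x x' h2, ← hmk x' (q x')] at h1
  exact (R x').symm (hex _ _ _ h1)

open Set Metric Topology in
theorem exists_compatible_isConjAt {k : ℕ} (hk : 1 ≤ k) {Ω : Set ℂ} (hΩ : IsOpen Ω)
    [SimplyConnectedSpace Ω] {f f' : ℂ × ℂ → ℂ} (hf : ∀ x ∈ Ω, AnalyticAt ℂ f (x, 0))
    (hf' : ∀ x ∈ Ω, AnalyticAt ℂ f' (x, 0)) (hfz : ∀ x ∈ Ω, f (x, 0) ≠ 0)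
    (hfz' : ∀ x ∈ Ω, f' (x, 0) ≠ 0) (hagree : ∀ x ∈ Ω, f (x, 0) = f' (x, 0)) :
    ∃ σ : ℂ → ℂ × ℂ → ℂ, ∀ x ∈ Ω, IsConjAt k f f' (σ x) x ∧
      ∀ᶠ x' in 𝓝 x, σ x =ᶠ[𝓝 (x', 0)] σ x' := by
  classical
  have hloc := fun x : Ω => exists_ball_isConjAt_extension hk hΩ hf hf' hfz hfz' hagree x.2
  have : LocallyPathConnectedSpace Ω := hΩ.locallyPathConnectedSpace
  have key : ∃ σ : Ω → ℂ × ℂ → ℂ, ∀ x, IsConjAt k f f' (σ x) x ∧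
      ∀ᶠ x' : Ω in 𝓝 x, σ x =ᶠ[𝓝 ((x' : ℂ), (0 : ℂ))] σ x' := by
    refine exists_compatible_choice (X := Ω) (A := ℂ × ℂ → ℂ)
      (fun x => (𝓝 ((x : ℂ), (0 : ℂ))).germSetoid ℂ) (fun x a => IsConjAt k f f' a x) ?_
      (fun x => (hloc x).1) ?_
    · intro x a b hab
      have hab' : a =ᶠ[𝓝 ((x : ℂ), (0 : ℂ))] b := hab
      have hι : Tendsto (fun x : Ω => ((x : ℂ), (0 : ℂ))) (𝓝 x) (𝓝 ((x : ℂ), (0 : ℂ))) :=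
        Continuous.tendsto (by fun_prop) _
      exact hι.eventually hab'.eventuallyEq_nhds
    · intro x
      obtain ⟨r, hr, hrΩ, hext⟩ := (hloc x).2
      refine ⟨Subtype.val ⁻¹' ball (x : ℂ) r, isOpen_ball.preimage continuous_subtype_val,
        mem_ball_self hr, fun x₂ hx₂ a ha => ?_, fun a a' ha ha' y hy hR z hz => ?_⟩
      · obtain ⟨g', hg', hg⟩ := hext x₂ hx₂ a ha
        exact ⟨g', hg', fun y hy => hg y hy⟩
      · have hmem : ∀ p ∈ ball (x : ℂ) r ×ˢ ({0} : Set ℂ), p = (p.1, 0) :=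
          fun p hp => Prod.ext rfl hp.2
        exact eventuallyEq_of_isPreconnected_of_analyticAt
          ((convex_ball (x : ℂ) r).isPreconnected.prod isPreconnected_singleton)
          (fun p hp => by rw [hmem p hp]; exact (ha ⟨p.1, hrΩ hp.1⟩ hp.1).1)
          (fun p hp => by rw [hmem p hp]; exact (ha' ⟨p.1, hrΩ hp.1⟩ hp.1).1)
          (x₀ := ((y : ℂ), 0)) ⟨hy, rfl⟩ hR (x := ((z : ℂ), 0)) ⟨hz, rfl⟩
  obtain ⟨σ, hσ⟩ := key
  refine ⟨fun x => if hx : x ∈ Ω then σ ⟨x, hx⟩ else 0, fun x hx => ?_⟩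
  have h := hσ ⟨x, hx⟩
  simp only [dif_pos hx]
  refine ⟨h.1, ?_⟩
  have h2 := h.2
  rw [nhds_subtype_eq_comap, eventually_comap] at h2
  filter_upwards [h2, hΩ.mem_nhds hx] with x' h3 h4
  simp only [dif_pos h4]
  exact h3 ⟨x', h4⟩ rfl

open Set Metric Topology in
theorem exists_nhds_injOn_of_eq_fst {g : ℂ × ℂ → ℂ} {x : ℂ} (hg : AnalyticAt ℂ g (x, 0))
    (h0 : ∀ᶠ p in 𝓝 ((x, 0) : ℂ × ℂ), p.2 = 0 → g p = p.1) :
    ∃ T ∈ 𝓝 ((x, 0) : ℂ × ℂ), ∀ p ∈ T, ∀ q ∈ T, p.2 = q.2 → g p = g q → p = q := by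
  have hm : AnalyticAt ℂ (fun p => g p - p.1) (x, 0) := hg.sub analyticAt_fst
  have hs := hm.hasStrictFDerivAt
  set M := fderiv ℂ (fun p => g p - p.1) (x, 0)
  have hM : M (1, 0) = 0 := by
    have h3 : HasDerivAt (fun s : ℂ => ((s, 0) : ℂ × ℂ)) (1, 0) x :=
      (hasDerivAt_id _).prodMk (hasDerivAt_const _ _)
    have h4 := HasFDerivAt.comp_hasDerivAt (f := fun s : ℂ => ((s, 0) : ℂ × ℂ)) x
      hs.hasFDerivAt h3
    refine h4.unique ((hasDerivAt_const x (0 : ℂ)).congr_of_eventuallyEq ?_)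
    have hι : Tendsto (fun x : ℂ => ((x, 0) : ℂ × ℂ)) (𝓝 x) (𝓝 (x, 0)) :=
      Continuous.tendsto (by fun_prop) _
    filter_upwards [hι.eventually h0] with s hs
    simp [hs rfl]
  have hb := hs.isLittleO.bound (c := 1 / 2) (by norm_num)
  rw [nhds_prod_eq, eventually_prod_iff] at hb
  obtain ⟨A, hA, B, hB, hAB⟩ := hb
  refine ⟨{p | A p ∧ B p}, hA.and hB, fun p hp q hq h2 hpq => ?_⟩
  have hb := hAB hp.1 hq.2
  have hd : p - q = (p.1 - q.1) • ((1, 0) : ℂ × ℂ) := by ext <;> simp [h2]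
  simp only [hd, map_smul, hM, hpq, smul_zero, sub_zero, norm_smul] at hb
  have h1 : ‖((1, 0) : ℂ × ℂ)‖ = 1 := by simp [Prod.norm_def]
  rw [h1, sub_sub_sub_cancel_left, norm_sub_rev q.1, mul_one] at hb
  have h5 : ‖p.1 - q.1‖ = 0 := by linarith [norm_nonneg (p.1 - q.1)]
  exact Prod.ext (sub_eq_zero.1 (norm_eq_zero.1 h5)) h2

open Set Metric Topology in
theorem exists_global_conj {k : ℕ} {Ω : Set ℂ} (hΩ : IsOpen Ω) {U : Set (ℂ × ℂ)} (hU : IsOpen U)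
    (hUΩ : Ω ×ˢ ({0} : Set ℂ) ⊆ U) {f f' : ℂ × ℂ → ℂ} {σ : ℂ → ℂ × ℂ → ℂ}
    (hσ : ∀ x ∈ Ω, IsConjAt k f f' (σ x) x ∧ ∀ᶠ x' in 𝓝 x, σ x =ᶠ[𝓝 (x', 0)] σ x') :
    ∃ (W : Set (ℂ × ℂ)) (g : ℂ × ℂ → ℂ), IsOpen W ∧ Ω ×ˢ ({0} : Set ℂ) ⊆ W ∧ W ⊆ U ∧
      AnalyticOnNhd ℂ g W ∧ (∀ p ∈ W, (p.1, 0) ∈ W ∧ g (p.1, 0) = p.1) ∧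
      (∀ p ∈ W, fderiv ℂ g p (f p, p.2 ^ k) = f' (g p, p.2)) ∧
      ∀ p ∈ W, ∀ q ∈ W, p.2 = q.2 → g p = g q → p = q := by
  classical
  have hr : ∀ x ∈ Ω, ∃ r > 0, (∀ p ∈ ball ((x, 0) : ℂ × ℂ) r, p ∈ U ∧ AnalyticAt ℂ (σ x) p ∧
      (fderiv ℂ (σ x) p (f p, p.2 ^ k) = f' (σ x p, p.2) ∧ (p.2 = 0 → σ x p = p.1)) ∧
      (p.1 ∈ Ω ∧ σ x =ᶠ[𝓝 (p.1, 0)] σ p.1)) ∧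
      ∀ p ∈ ball ((x, 0) : ℂ × ℂ) r, ∀ q ∈ ball ((x, 0) : ℂ × ℂ) r, p.2 = q.2 →
        σ x p = σ x q → p = q := by
    intro x hx
    obtain ⟨h1, h2⟩ := hσ x hx
    obtain ⟨T, hT, hinj⟩ := exists_nhds_injOn_of_eq_fst h1.1 (h1.2.mono fun p hp => hp.2)
    have hfst : Tendsto (Prod.fst : ℂ × ℂ → ℂ) (𝓝 (x, 0)) (𝓝 x) := continuous_fst.tendsto _
    have hev : ∀ᶠ p in 𝓝 ((x, 0) : ℂ × ℂ), p ∈ T ∧ (p ∈ U ∧ AnalyticAt ℂ (σ x) p ∧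
      (fderiv ℂ (σ x) p (f p, p.2 ^ k) = f' (σ x p, p.2) ∧ (p.2 = 0 → σ x p = p.1)) ∧
      (p.1 ∈ Ω ∧ σ x =ᶠ[𝓝 (p.1, 0)] σ p.1)) := by
      filter_upwards [hT, hU.mem_nhds (hUΩ ⟨hx, rfl⟩), h1.1.eventually_analyticAt, h1.2,
        hfst.eventually (hΩ.mem_nhds hx), hfst.eventually h2] with p a b c d e f
      exact ⟨a, b, c, d, e, f⟩
    obtain ⟨r, hr, hb⟩ := nhds_basis_ball.eventually_iff.1 hev
    exact ⟨r, hr, fun p hp => (hb hp).2, fun p hp q hq => hinj p (hb hp).1 q (hb hq).1⟩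
  choose! r hr0 hr hinj using hr
  have hproj : ∀ x p, p ∈ ball ((x, 0) : ℂ × ℂ) (r x) → (p.1, 0) ∈ ball ((x, 0) : ℂ × ℂ) (r x) := by
    intro x p hp
    rw [← ball_prod_same] at hp ⊢
    exact ⟨hp.1, mem_ball_self ((dist_nonneg).trans_lt hp.1)⟩
  have hcompat : ∀ x ∈ Ω, ∀ x' ∈ Ω, ∀ p ∈ ball ((x, 0) : ℂ × ℂ) (r x),
      p ∈ ball ((x', 0) : ℂ × ℂ) (r x') → σ x p = σ x' p := by
    intro x hx x' hx' p hp hp'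
    refine (eventuallyEq_of_isPreconnected_of_analyticAt
      (S := ball ((x, 0) : ℂ × ℂ) (r x) ∩ ball ((x', 0) : ℂ × ℂ) (r x'))
      ((convex_ball _ _).inter (convex_ball _ _)).isPreconnected
      (fun q hq => (hr x hx q hq.1).2.1) (fun q hq => (hr x' hx' q hq.2).2.1)
      (x₀ := (p.1, 0)) ⟨hproj x p hp, hproj x' p hp'⟩ ?_ ⟨hp, hp'⟩).eq_of_nhds
    exact (hr x hx p hp).2.2.2.2.trans (hr x' hx' p hp').2.2.2.2.symm
  let g : ℂ × ℂ → ℂ := fun p =>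
    if h : ∃ x ∈ Ω, p ∈ ball ((x, 0) : ℂ × ℂ) (r x) then σ h.choose p else 0
  have hg : ∀ x ∈ Ω, ∀ p ∈ ball ((x, 0) : ℂ × ℂ) (r x), g p = σ x p := by
    intro x hx p hp
    have h : ∃ x ∈ Ω, p ∈ ball ((x, 0) : ℂ × ℂ) (r x) := ⟨x, hx, hp⟩
    simp only [g, dif_pos h]
    exact hcompat _ h.choose_spec.1 _ hx p h.choose_spec.2 hp
  have hge : ∀ x ∈ Ω, ∀ p ∈ ball ((x, 0) : ℂ × ℂ) (r x), g =ᶠ[𝓝 p] σ x := fun x hx p hp =>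
    eventually_of_mem (isOpen_ball.mem_nhds hp) (hg x hx)
  let V : ℂ → Set (ℂ × ℂ) := fun x => ball ((x, 0) : ℂ × ℂ) (r x / 4) ∩
    (fun p => g p - p.1) ⁻¹' ball 0 (r x / 4)
  have hVb : ∀ x ∈ Ω, V x ⊆ ball ((x, 0) : ℂ × ℂ) (r x) := fun x hx =>
    inter_subset_left.trans (ball_subset_ball (by linarith [hr0 x hx]))
  have hg0 : ∀ x ∈ Ω, ∀ p ∈ ball ((x, 0) : ℂ × ℂ) (r x), g (p.1, 0) = p.1 := fun x hx p hp => by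
    rw [hg x hx _ (hproj x p hp)]
    exact (hr x hx _ (hproj x p hp)).2.2.1.2 rfl
  have hkey : ∀ x ∈ Ω, ∀ x' ∈ Ω, r x' ≤ r x → ∀ p ∈ V x, ∀ q ∈ V x', p.2 = q.2 → g p = g q →
      p = q := by
    intro x hx x' hx' hle p hp q hq h2 hpq
    have hpb := hVb x hx hp
    have hq' : q ∈ ball ((x, 0) : ℂ × ℂ) (r x) := by
      have a1 := hp.1
      have a2 := hp.2
      have a3 := hq.2
      rw [← ball_prod_same] at a1
      obtain ⟨a4, a5⟩ := a1
      simp only [mem_preimage, mem_ball, dist_eq_norm, sub_zero] at a2 a3 a4 a5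
      rw [← ball_prod_same]
      constructor
      · rw [mem_ball, dist_eq_norm]
        calc ‖q.1 - x‖ = ‖(p.1 - x) + (g p - p.1) - (g q - q.1)‖ := by rw [hpq]; congr 1; ring
          _ ≤ ‖p.1 - x‖ + ‖g p - p.1‖ + ‖g q - q.1‖ :=
            (norm_sub_le _ _).trans (by gcongr; exact norm_add_le _ _)
          _ < r x := by linarith [hr0 x hx]
      · rw [mem_ball, dist_eq_norm, sub_zero, ← h2]
        linarith [hr0 x hx]
    rw [hg x hx p hpb, hg x hx q hq'] at hpq
    exact hinj x hx p hpb q hq' h2 hpq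
  refine ⟨⋃ x ∈ Ω, V x, g, isOpen_biUnion fun x hx => ?_, ?_, ?_, ?_, ?_, ?_, ?_⟩
  · refine ContinuousOn.isOpen_inter_preimage (fun p hp => ?_) isOpen_ball isOpen_ball
    have hp' : p ∈ ball ((x, 0) : ℂ × ℂ) (r x) :=
      ball_subset_ball (by linarith [hr0 x hx]) hp
    exact (((hr x hx p hp').2.1.congr (hge x hx p hp').symm).continuousAt.sub
      continuousAt_fst).continuousWithinAt
  · rintro ⟨x, y⟩ ⟨hx, rfl : y = 0⟩
    refine mem_biUnion hx ⟨mem_ball_self (by linarith [hr0 x hx]), ?_⟩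
    have := hg0 x hx (x, 0) (mem_ball_self (hr0 x hx))
    simp only [mem_preimage] at this ⊢
    rw [this, sub_self]
    exact mem_ball_self (by linarith [hr0 x hx])
  · exact iUnion₂_subset fun x hx p hp => (hr x hx p (hVb x hx hp)).1
  · intro p hp
    obtain ⟨x, hx, hp⟩ := mem_iUnion₂.1 hp
    have hp' := hVb x hx hp
    exact (hr x hx p hp').2.1.congr (hge x hx p hp').symm
  · intro p hp
    obtain ⟨x, hx, hp⟩ := mem_iUnion₂.1 hp
    have hp' := hVb x hx hp
    have h0 := hg0 x hx p hp'
    refine ⟨mem_biUnion hx ⟨?_, ?_⟩, h0⟩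
    · have := hp.1
      rw [← ball_prod_same] at this ⊢
      exact ⟨this.1, mem_ball_self (by linarith [hr0 x hx])⟩
    · simp only [mem_preimage]
      rw [h0, sub_self]
      exact mem_ball_self (by linarith [hr0 x hx])
  · intro p hp
    obtain ⟨x, hx, hp⟩ := mem_iUnion₂.1 hp
    have hp' := hVb x hx hp
    rw [(hge x hx p hp').fderiv_eq, hg x hx p hp']
    exact (hr x hx p hp').2.2.1.1
  · intro p hp q hq h2 hpq
    obtain ⟨x, hx, hp⟩ := mem_iUnion₂.1 hp
    obtain ⟨x', hx', hq⟩ := mem_iUnion₂.1 hq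
    rcases le_total (r x') (r x) with h | h
    · exact hkey x hx x' hx' h p hp q hq h2 hpq
    · exact (hkey x' hx' x hx h q hq p hp h2.symm hpq.symm).symm

open Set Metric Topology in
/-- Hadamard's lemma: division of a holomorphic function of two variables by the second one. -/
theorem analyticAt_dslope_snd {g : ℂ × ℂ → ℂ} {x : ℂ} (hg : AnalyticAt ℂ g (x, 0)) :
    AnalyticAt ℂ (fun p : ℂ × ℂ => dslope (fun t => g (p.1, t)) 0 p.2) (x, 0) := by
  obtain ⟨ρ, hρ, hb⟩ := nhds_basis_ball.eventually_iff.1 hg.eventually_analyticAt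
  set V := ball ((x, 0) : ℂ × ℂ) ρ with hV
  have hstar : ∀ p ∈ V, ∀ τ ∈ Icc (0 : ℝ) 1, (p.1, (τ : ℂ) * p.2) ∈ V := fun p hp τ hτ => by
    rw [hV, ← ball_prod_same] at hp ⊢
    refine ⟨hp.1, ?_⟩
    have := hp.2
    rw [mem_ball_zero_iff] at this ⊢
    simp only [norm_mul, Complex.norm_real, Real.norm_eq_abs, abs_of_nonneg hτ.1]
    exact (mul_le_of_le_one_left (norm_nonneg _) hτ.2).trans_lt this
  let D : ℂ × ℂ → ℂ := fun p => fderiv ℂ g p (0, 1)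
  have hD : AnalyticOnNhd ℂ D V := fun p hp =>
    ((ContinuousLinearMap.apply ℂ ℂ ((0, 1) : ℂ × ℂ)).analyticAt _).comp (hb hp).fderiv
  refine (analyticOnNhd_radial_integral isOpen_ball hstar hD _ (mem_ball_self hρ)).congr ?_
  filter_upwards [ball_mem_nhds _ hρ] with p hp
  have hp' := hp
  rw [← ball_prod_same] at hp'
  have hmem : ∀ t ∈ ball (0 : ℂ) ρ, (p.1, t) ∈ V := fun t ht => by
    rw [hV, ← ball_prod_same]; exact ⟨hp'.1, ht⟩
  have hgd : ∀ t ∈ ball (0 : ℂ) ρ, HasDerivAt (fun t => g (p.1, t)) (D (p.1, t)) t := by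
    intro t ht
    have h3 : HasDerivAt (fun t : ℂ => ((p.1, t) : ℂ × ℂ)) (0, 1) t :=
      (hasDerivAt_const _ _).prodMk (hasDerivAt_id _)
    exact HasFDerivAt.comp_hasDerivAt (f := fun t : ℂ => ((p.1, t) : ℂ × ℂ)) t
      (hb (hmem t ht)).differentiableAt.hasFDerivAt h3
  have hder : ∀ t ∈ ball (0 : ℂ) ρ, HasDerivAt
      (fun t => t * (∫ τ in (0 : ℝ)..1, D (p.1, (τ : ℂ) * t)) - g (p.1, t)) 0 t := fun t ht => by
    have := (hasDerivAt_mul_radial_integral isOpen_ball hstar hD (hmem t ht)).sub (hgd t ht)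
    rwa [sub_self] at this
  by_cases h0 : p.2 = 0
  · rw [h0, dslope_same, (hgd 0 (mem_ball_self hρ)).deriv]
    simp
  · have := isOpen_ball.is_const_of_deriv_eq_zero (convex_ball (0 : ℂ) ρ).isPreconnected
      (fun t ht => (hder t ht).differentiableAt.differentiableWithinAt)
      (fun t ht => (hder t ht).deriv) hp'.2 (mem_ball_self hρ)
    rw [dslope_of_ne _ h0, slope_def_field, eq_div_iff (by simpa using h0)]
    simp only [zero_mul, zero_sub, Prod.mk.eta, sub_zero] at this ⊢
    linear_combination this

/-- **Gluing Lemma along a common leaf, sufficiency (simply connected `Ω`).**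
If `X = f∂x + yᵏ∂y` and `X' = f'∂x + yᵏ∂y` are holomorphic near `Ω × {0}` with
`f, f'` nowhere vanishing and `f(x,0) = f'(x,0)` on the simply connected open set
`Ω`, then on some neighborhood `W` of `Ω × {0}` there is a holomorphic `φ` such
that `Φ(x,y) = (x + y·φ(x,y), y)` is injective on `W`, fixes `Ω × {0}` pointwise,
and conjugates `X` to `X'`. -/
theorem gluing_lemma_common_leaf_sufficient
    (Ω : Set ℂ) (hΩo : IsOpen Ω) (hΩsc : SimplyConnectedSpace Ω)
    (k : ℕ) (hk : 1 ≤ k)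
    (U : Set (ℂ × ℂ)) (hUo : IsOpen U) (hUΩ : Ω ×ˢ ({0} : Set ℂ) ⊆ U)
    (f f' : ℂ × ℂ → ℂ)
    (hf : AnalyticOnNhd ℂ f U) (hf' : AnalyticOnNhd ℂ f' U)
    (hfz : ∀ p ∈ U, f p ≠ 0) (hf'z : ∀ p ∈ U, f' p ≠ 0)
    (hagree : ∀ x ∈ Ω, f (x, 0) = f' (x, 0)) :
    ∃ (W : Set (ℂ × ℂ)) (φ : ℂ × ℂ → ℂ),
      IsOpen W ∧ Ω ×ˢ ({0} : Set ℂ) ⊆ W ∧ W ⊆ U ∧ AnalyticOnNhd ℂ φ W ∧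
      Set.InjOn (fun p : ℂ × ℂ => ((p.1 + p.2 * φ p, p.2) : ℂ × ℂ)) W ∧
      (∀ x ∈ Ω, (((x : ℂ) + 0 * φ (x, 0), (0 : ℂ)) : ℂ × ℂ) = (x, 0)) ∧
      ∀ p ∈ W, fderiv ℂ (fun q : ℂ × ℂ => (q.1 + q.2 * φ q, q.2)) p (f p, p.2 ^ k)
        = ((f' (p.1 + p.2 * φ p, p.2), p.2 ^ k) : ℂ × ℂ) := by
  have : SimplyConnectedSpace Ω := hΩsc
  have hmem : ∀ x ∈ Ω, ((x, 0) : ℂ × ℂ) ∈ U := fun x hx => hUΩ ⟨hx, rfl⟩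
  obtain ⟨σ, hσ⟩ := exists_compatible_isConjAt hk hΩo (fun x hx => hf _ (hmem x hx))
    (fun x hx => hf' _ (hmem x hx)) (fun x hx => hfz _ (hmem x hx))
    (fun x hx => hf'z _ (hmem x hx)) hagree
  obtain ⟨W, g, hWo, hΩW, hWU, hg, hg0, hgconj, hginj⟩ := exists_global_conj hΩo hUo hUΩ hσ
  let φ : ℂ × ℂ → ℂ := fun p => dslope (fun t => g (p.1, t)) 0 p.2
  have hφ : ∀ p ∈ W, p.1 + p.2 * φ p = g p := fun p hp => by
    have := sub_smul_dslope (fun t => g (p.1, t)) 0 p.2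
    simp only [sub_zero, smul_eq_mul, (hg0 p hp).2] at this
    simp only [φ, this, add_sub_cancel]
  refine ⟨W, φ, hWo, hΩW, hWU, fun p hp => ?_, fun p hp q hq hpq => ?_, fun x _ => by simp,
    fun p hp => ?_⟩
  · by_cases h0 : p.2 = 0
    · have hp0 : p = (p.1, 0) := Prod.ext rfl h0
      rw [hp0]
      exact analyticAt_dslope_snd (hg _ (hg0 p hp).1)
    · refine (((hg p hp).sub analyticAt_fst).div analyticAt_snd h0).congr ?_
      filter_upwards [hWo.mem_nhds hp, continuousAt_snd.eventually_ne h0] with q hq hq0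
      simp only [Pi.div_apply, Pi.sub_apply]
      rw [div_eq_iff hq0, ← hφ q hq]
      ring
  · simp only [Prod.mk.injEq, hφ p hp, hφ q hq] at hpq
    exact hginj p hp q hq hpq.2 hpq.1
  · have hev : (fun q : ℂ × ℂ => (q.1 + q.2 * φ q, q.2)) =ᶠ[nhds p] fun q => (g q, q.2) := by
      filter_upwards [hWo.mem_nhds hp] with q hq
      rw [hφ q hq]
    rw [hev.fderiv_eq, ((hg p hp).differentiableAt.hasFDerivAt.prodMk hasFDerivAt_snd).fderiv,
      hφ p hp, ← hgconj p hp]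
    rfl
end

section
/- Let f, g be holomorphic near 0 ∈ ℂ with f(0) ≠ 0 and g(0) ≠ 0, and consider the vector field X = x²∂x + (f(y)·x + y·g(y))∂y on a neighborhood of 0 ∈ ℂ². Then there exist a constant α ∈ ℂ, α ≠ 0, a local biholomorphism η of (ℂ,0) (η(0) = 0, η'(0) ≠ 0), a holomorphic function u near 0 ∈ ℂ² with u(0) ≠ 0, and a holomorphic function F near 0 ∈ ℂ with F(0) ≠ 0, such that the map Φ(x,y) = (α·x, η(y)) satisfies DΦ(p)·X(p) = u(p)·X_F(Φ(p)) near 0, where X_F = x²∂x + (y + x·F(y))∂y. -/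
open Filter

open Topology in
theorem AnalyticAt.exists_primitive {k : ℂ → ℂ} {c : ℂ} (hk : AnalyticAt ℂ k c) :
    ∃ h : ℂ → ℂ, AnalyticAt ℂ h c ∧ ∀ᶠ y in 𝓝 c, HasDerivAt h (k y) y := by
  obtain ⟨r, hr, hkr⟩ := Metric.eventually_nhds_iff_ball.1 hk.eventually_analyticAt
  obtain ⟨h, hh⟩ := DifferentiableOn.isExactOn_ball
    fun y hy => (hkr y hy).differentiableAt.differentiableWithinAt
  have hev : ∀ᶠ y in 𝓝 c, HasDerivAt h (k y) y :=
    Filter.eventually_of_mem (Metric.ball_mem_nhds c hr) hh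
  exact ⟨h, Complex.analyticAt_iff_eventually_differentiableAt.2
    (hev.mono fun y hy => hy.differentiableAt), hev⟩

open Topology in
/-- A vector field `y g(y) ∂y` with `g 0 ≠ 0` is analytically linearizable. -/
theorem AnalyticAt.exists_linearization {g : ℂ → ℂ} (hg : AnalyticAt ℂ g 0) (hg0 : g 0 ≠ 0) :
    ∃ η : ℂ → ℂ, AnalyticAt ℂ η 0 ∧ η 0 = 0 ∧ deriv η 0 ≠ 0 ∧
      ∀ᶠ y in 𝓝 (0 : ℂ), deriv η y * (y * g y) = g 0 * η y := by
  have hw : AnalyticAt ℂ (fun y => g 0 / g y) 0 := analyticAt_const.div hg hg0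
  obtain ⟨p, hp⟩ := hw
  obtain ⟨h, hh, hder⟩ := AnalyticAt.exists_primitive
    (HasFPowerSeriesAt.has_fpower_series_dslope_fslope hp).analyticAt
  have hη : ∀ᶠ y in 𝓝 (0 : ℂ),
      HasDerivAt (fun y => y * Complex.exp (h y)) (Complex.exp (h y) * (g 0 / g y)) y := by
    filter_upwards [hder] with y hy
    refine ((hasDerivAt_id y).mul hy.cexp).congr_deriv ?_
    have hslope := sub_smul_dslope (fun y => g 0 / g y) 0 y
    simp only [sub_zero, smul_eq_mul, div_self hg0] at hslope
    simp only [id]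
    linear_combination Complex.exp (h y) * hslope
  refine ⟨fun y => y * Complex.exp (h y), analyticAt_id.mul hh.cexp, by simp, ?_, ?_⟩
  · rw [hη.self_of_nhds.deriv]
    simp [hg0]
  · filter_upwards [hη, hg.continuousAt.eventually_ne hg0] with y hy hgy
    rw [hy.deriv]
    field_simp

open Topology in
/-- An analytic germ factors through any analytic local coordinate. -/
theorem AnalyticAt.exists_eventuallyEq_comp {φ η : ℂ → ℂ} {c : ℂ} (hφ : AnalyticAt ℂ φ c)
    (hη : AnalyticAt ℂ η c) (hη' : deriv η c ≠ 0) :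
    ∃ F : ℂ → ℂ, AnalyticAt ℂ F (η c) ∧ ∀ᶠ y in 𝓝 c, F (η y) = φ y := by
  have hr := hη.analyticAt_localInverse hη'
  have hrc : hη.hasStrictDerivAt.localInverse _ _ _ hη' (η c) = c :=
    HasStrictFDerivAt.localInverse_apply_image ..
  refine ⟨φ ∘ hη.hasStrictDerivAt.localInverse _ _ _ hη', (hrc.symm ▸ hφ).comp hr, ?_⟩
  filter_upwards [HasStrictDerivAt.eventually_left_inverse hη.hasStrictDerivAt hη'] with y hy
  simp only [Function.comp_apply, hy]

/-- **Lemma (final normalization, versal form).** The vector field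
`X = x²∂x + (f(y)·x + y·g(y))∂y` with `f 0 ≠ 0`, `g 0 ≠ 0` is carried, by a map
`Φ(x,y) = (α·x, η(y))` with `α ≠ 0` and `η` a local biholomorphism of `(ℂ,0)`,
onto a nonvanishing multiple of `X_F = x²∂x + (y + x·F(y))∂y`, where `F` is
holomorphic near `0` with `F 0 ≠ 0`. -/
theorem final_normalization_versal
    (f g : ℂ → ℂ) (hf : AnalyticAt ℂ f 0) (hg : AnalyticAt ℂ g 0)
    (hf0 : f 0 ≠ 0) (hg0 : g 0 ≠ 0) :
    ∃ (α : ℂ) (η : ℂ → ℂ) (u : ℂ × ℂ → ℂ) (F : ℂ → ℂ),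
      α ≠ 0 ∧ AnalyticAt ℂ η 0 ∧ η 0 = 0 ∧ deriv η 0 ≠ 0 ∧
      AnalyticAt ℂ u 0 ∧ u 0 ≠ 0 ∧ AnalyticAt ℂ F 0 ∧ F 0 ≠ 0 ∧
      ∀ᶠ p in nhds (0 : ℂ × ℂ),
        fderiv ℂ (fun q : ℂ × ℂ => (α * q.1, η q.2)) p
            (p.1 ^ 2, f p.2 * p.1 + p.2 * g p.2)
          = u p • (((α * p.1) ^ 2, η p.2 + (α * p.1) * F (η p.2)) : ℂ × ℂ) := by
  obtain ⟨η, hη, hη0, hη', hlin⟩ := hg.exists_linearization hg0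
  obtain ⟨F, hF, hFη⟩ := (hη.deriv.mul hf).exists_eventuallyEq_comp hη hη'
  rw [hη0] at hF
  refine ⟨(g 0)⁻¹, η, fun _ => g 0, F, inv_ne_zero hg0, hη, hη0, hη', analyticAt_const, hg0,
    hF, ?_, ?_⟩
  · have h0 := hFη.self_of_nhds
    rw [hη0] at h0
    rw [h0]
    exact mul_ne_zero hη' hf0
  have hsnd : Tendsto (Prod.snd : ℂ × ℂ → ℂ) (nhds 0) (nhds 0) :=
    continuous_snd.tendsto 0
  filter_upwards [hsnd.eventually hlin, hsnd.eventually hFη,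
    hsnd.eventually hη.eventually_analyticAt] with p hlp hFp hηp
  have hd₂ : HasFDerivAt (fun q : ℂ × ℂ => η q.2)
      (deriv η p.2 • ContinuousLinearMap.snd ℂ ℂ ℂ) p :=
    hηp.differentiableAt.hasDerivAt.comp_hasFDerivAt p hasFDerivAt_snd
  have hd : HasFDerivAt (fun q : ℂ × ℂ => ((g 0)⁻¹ * q.1, η q.2)) _ p :=
    (hasFDerivAt_fst.const_mul (g 0)⁻¹).prodMk hd₂
  rw [hd.fderiv]
  ext
  · simp
    field_simp
  · simp only [Pi.mul_apply] at hFp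
    simp [hFp]
    field_simp
    linear_combination hlp
end
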